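/- arXiv:1801.01028 — 2 statements merged into one kernel-verified Lean document; each statement's English description precedes it below -/
import Mathlib

section
/- (Hölder estimate for extremal inequalities) There exist constants ε₄ > 0, α ∈ (0,1) and C > 0 depending only on λ, Λ, C₀, K and d, such that: if f ∈ L^d(B₁) ∩ C(B₁) with ‖f‖_{L^d(B₁)} ≤ ε₄, and u : ℝ^d → ℝ is a continuous function with −1/2 ≤ u ≤ 1/2 on ℝ^d which is both a viscosity subsolution of P⁺(D²u) + P⁺_K(u) + C₀|Du| ≥ −f⁻ in B₁ and a viscosity supersolution of P⁻(D²u) + P⁻_K(u) − C₀|Du| ≤ f⁺ in B₁, then |u(x) − u(0)| ≤ C|x|^α for all x ∈ ℝ^d. -/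
open MeasureTheory Metric Set
open scoped RealInnerProductSpace ENNReal

noncomputable section

/-- `d`-dimensional Euclidean space. -/
abbrev Ed (d : ℕ) : Type := EuclideanSpace ℝ (Fin d)

/-- A real-valued function on `ℝ^d` is bounded. -/
def IsBddFun {d : ℕ} (φ : Ed d → ℝ) : Prop := ∃ M, ∀ x, |φ x| ≤ M

/-- The open cube of half side length `δ` centered at `x`. -/
def cubeAt {d : ℕ} (x : Ed d) (δ : ℝ) : Set (Ed d) := {y | ∀ i, |y i - x i| < δ}

/-- The open cube `Q_δ = (-δ, δ)^d`. -/
def cube (d : ℕ) (δ : ℝ) : Set (Ed d) := cubeAt 0 δ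

/-- Hessian matrix of `φ` at `x` (matrix of second derivatives). -/
def hess {d : ℕ} (φ : Ed d → ℝ) (x : Ed d) : Matrix (Fin d) (Fin d) ℝ :=
  Matrix.of fun i j =>
    iteratedFDeriv ℝ 2 φ x ![EuclideanSpace.single i (1 : ℝ), EuclideanSpace.single j (1 : ℝ)]

/-- Symmetric matrices `A` with `λ I ≤ A ≤ Λ I`. -/
def ellipticSet (lam Lam : ℝ) (d : ℕ) : Set (Matrix (Fin d) (Fin d) ℝ) :=
  {A | A.IsSymm ∧ (A - lam • (1 : Matrix (Fin d) (Fin d) ℝ)).PosSemidef ∧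
      (Lam • (1 : Matrix (Fin d) (Fin d) ℝ) - A).PosSemidef}

/-- The Pucci maximal operator `P⁺`. -/
def pucciPlus {d : ℕ} (lam Lam : ℝ) (X : Matrix (Fin d) (Fin d) ℝ) : ℝ :=
  sSup ((fun A => (A * X).trace) '' ellipticSet lam Lam d)

/-- The Pucci minimal operator `P⁻`. -/
def pucciMinus {d : ℕ} (lam Lam : ℝ) (X : Matrix (Fin d) (Fin d) ℝ) : ℝ :=
  sInf ((fun A => (A * X).trace) '' ellipticSet lam Lam d)

/-- The Lévy kernel condition: `K ≥ 0` measurable with `∫ min(|z|²,1) K(z) dz < ∞`. -/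
def KernCond {d : ℕ} (K : Ed d → ℝ) : Prop :=
  Measurable K ∧ (∀ z, 0 ≤ K z) ∧ Integrable (fun z : Ed d => min (‖z‖ ^ 2) 1 * K z)

/-- The rescaled kernel `K_r(z) = r^{d+2} K(rz)`. -/
def Kresc {d : ℕ} (K : Ed d → ℝ) (r : ℝ) (z : Ed d) : ℝ := r ^ (d + 2) * K (r • z)

/-- The second-order increment `u(x+z) − u(x) − 1_{B_{1/r}}(z) Du(x)·z`. -/
def deltaOp {d : ℕ} (φ : Ed d → ℝ) (r : ℝ) (x z : Ed d) : ℝ :=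
  φ (x + z) - φ x - (Metric.ball (0 : Ed d) (1 / r)).indicator (fun w => ⟪gradient φ x, w⟫) z

/-- The maximal nonlocal Pucci operator `P⁺_{K,r}`. -/
def nlPlus {d : ℕ} (K : Ed d → ℝ) (r : ℝ) (φ : Ed d → ℝ) (x : Ed d) : ℝ :=
  ∫ z, max (deltaOp φ r x z) 0 * Kresc K r z

/-- The minimal nonlocal Pucci operator `P⁻_{K,r}`. -/
def nlMinus {d : ℕ} (K : Ed d → ℝ) (r : ℝ) (φ : Ed d → ℝ) (x : Ed d) : ℝ :=
  -∫ z, max (-deltaOp φ r x z) 0 * Kresc K r z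

/-- Viscosity supersolution of `−P⁻(D²u) − P⁻_{K,r}(u) + C₀ r |Du| ≥ f` in `O`. -/
def SupersolExtremal {d : ℕ} (lam Lam C0 r : ℝ) (K f : Ed d → ℝ) (O : Set (Ed d))
    (u : Ed d → ℝ) : Prop :=
  ∀ φ : Ed d → ℝ, ContDiff ℝ 2 φ → IsBddFun φ → ∀ x ∈ O, (∀ y, φ y ≤ u y) → u x = φ x →
    f x ≤ -pucciMinus lam Lam (hess φ x) - nlMinus K r φ x + C0 * r * ‖gradient φ x‖

/-- Viscosity subsolution of `P⁺(D²u) + P⁺_K(u) + C₀|Du| ≥ g` in `O`. -/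
def SubsolPlus {d : ℕ} (lam Lam C0 : ℝ) (K g : Ed d → ℝ) (O : Set (Ed d)) (u : Ed d → ℝ) : Prop :=
  ∀ φ : Ed d → ℝ, ContDiff ℝ 2 φ → IsBddFun φ → ∀ x ∈ O, (∀ y, u y ≤ φ y) → u x = φ x →
    g x ≤ pucciPlus lam Lam (hess φ x) + nlPlus K 1 φ x + C0 * ‖gradient φ x‖

/-- Viscosity supersolution of `P⁻(D²u) + P⁻_K(u) − C₀|Du| ≤ g` in `O`. -/
def SupersolMinus {d : ℕ} (lam Lam C0 : ℝ) (K g : Ed d → ℝ) (O : Set (Ed d)) (u : Ed d → ℝ) : Prop :=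
  ∀ φ : Ed d → ℝ, ContDiff ℝ 2 φ → IsBddFun φ → ∀ x ∈ O, (∀ y, φ y ≤ u y) → u x = φ x →
    pucciMinus lam Lam (hess φ x) + nlMinus K 1 φ x - C0 * ‖gradient φ x‖ ≤ g x

/-- Negative part `f⁻ = −min{f,0}`. -/
def nPart {d : ℕ} (f : Ed d → ℝ) : Ed d → ℝ := fun x => max (-f x) 0

/-- Positive part `f⁺ = max{f,0}`. -/
def pPart {d : ℕ} (f : Ed d → ℝ) : Ed d → ℝ := fun x => max (f x) 0

/-- The `L^p` norm of `f` on a set `S`. -/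
def LnormOn {d : ℕ} (p : ℝ) (S : Set (Ed d)) (f : Ed d → ℝ) : ℝ :=
  (∫ x in S, |f x| ^ p) ^ (1 / p)

/-- The nonlocal contact set `Γ^{n,−}_O(v)`. -/
def nContact {d : ℕ} (O : Set (Ed d)) (v : Ed d → ℝ) : Set (Ed d) :=
  {x | x ∈ O ∧ v x < sInf (v '' Oᶜ) ∧
      ∃ p : Ed d, ∀ y, Metric.infDist y O < Metric.diam O → v x + ⟪p, y - x⟫ ≤ v y}

/-- The set `G^u_M` of points where `u` is touched from below by a paraboloid of opening `M`. -/
def GSet {d : ℕ} (u : Ed d → ℝ) (M : ℝ) : Set (Ed d) :=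
  {x | ∃ ρ > 0, ∃ A C : ℝ, ∃ B : Ed d, |A| + ‖B‖ + |C| ≤ M ∧ u x = A ∧
      ∀ y ∈ Metric.ball x ρ, A + ⟪B, y - x⟫ - C / 2 * ‖y - x‖ ^ 2 ≤ u y}

/-- The bad set `B^u_M`. -/
def BSet {d : ℕ} (u : Ed d → ℝ) (M : ℝ) : Set (Ed d) := (GSet u M)ᶜ

/-- Upper semicontinuous envelope `u*`. -/
def usEnv {d : ℕ} (u : Ed d → ℝ) (x : Ed d) : ℝ :=
  ⨅ ρ : {ρ : ℝ // 0 < ρ}, ⨆ y : {y : Ed d // ‖y - x‖ ≤ ρ.1}, u y.1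

/-- Lower semicontinuous envelope `u_*`. -/
def lsEnv {d : ℕ} (u : Ed d → ℝ) (x : Ed d) : ℝ :=
  ⨆ ρ : {ρ : ℝ // 0 < ρ}, ⨅ y : {y : Ed d // ‖y - x‖ ≤ ρ.1}, u y.1

/-- A modulus of continuity. -/
def IsModulus (m : ℝ → ℝ) : Prop :=
  (∀ t, 0 ≤ m t) ∧ Monotone m ∧ m 0 = 0 ∧ ContinuousAt m 0

/-- The uniform exterior ball condition. -/
def ExtBallCond {d : ℕ} (Ω : Set (Ed d)) : Prop :=
  ∃ ρ > 0, ∀ ξ ∈ frontier Ω, ∃ y ∈ Ωᶜ, Metric.ball y ρ ⊆ Ωᶜ ∧ ξ ∈ Metric.sphere y ρ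

section HJBI

variable {d : ℕ} {𝒜 ℬ : Type}

/-- The linear nonlocal operator `I_{ab}[x, φ]`. -/
def Iop (N : 𝒜 → ℬ → Ed d → Ed d → ℝ) (a : 𝒜) (b : ℬ) (φ : Ed d → ℝ) (x : Ed d) : ℝ :=
  ∫ z, (φ (x + z) - φ x -
      (Metric.ball (0 : Ed d) 1).indicator (fun w => ⟪gradient φ x, w⟫) z) * N a b x z

/-- The HJBI operator evaluated at `φ`, with the zeroth order slot evaluated at `s`. -/
def HJBIat (aM : 𝒜 → ℬ → Ed d → Matrix (Fin d) (Fin d) ℝ) (bV : 𝒜 → ℬ → Ed d → Ed d)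
    (cF fF : 𝒜 → ℬ → Ed d → ℝ) (N : 𝒜 → ℬ → Ed d → Ed d → ℝ)
    (φ : Ed d → ℝ) (s : ℝ) (x : Ed d) : ℝ :=
  ⨆ a, ⨅ b, (-(aM a b x * hess φ x).trace - Iop N a b φ x +
    ⟪bV a b x, gradient φ x⟫ + cF a b x * s + fF a b x)

/-- The HJBI operator `ℐφ(x)`. -/
def HJBIop (aM : 𝒜 → ℬ → Ed d → Matrix (Fin d) (Fin d) ℝ) (bV : 𝒜 → ℬ → Ed d → Ed d)
    (cF fF : 𝒜 → ℬ → Ed d → ℝ) (N : 𝒜 → ℬ → Ed d → Ed d → ℝ)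
    (φ : Ed d → ℝ) (x : Ed d) : ℝ :=
  HJBIat aM bV cF fF N φ (φ x) x

/-- Viscosity subsolution of `ℐu = 0` in `Ω` (test function formulation). -/
def SubsolHJBI (aM : 𝒜 → ℬ → Ed d → Matrix (Fin d) (Fin d) ℝ) (bV : 𝒜 → ℬ → Ed d → Ed d)
    (cF fF : 𝒜 → ℬ → Ed d → ℝ) (N : 𝒜 → ℬ → Ed d → Ed d → ℝ) (Ω : Set (Ed d))
    (u : Ed d → ℝ) : Prop :=
  ∀ φ : Ed d → ℝ, ContDiff ℝ 2 φ → IsBddFun φ → ∀ x ∈ Ω, (∀ y, u y ≤ φ y) → u x = φ x →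
    HJBIop aM bV cF fF N φ x ≤ 0

/-- Viscosity supersolution of `ℐu = 0` in `Ω` (test function formulation). -/
def SupersolHJBI (aM : 𝒜 → ℬ → Ed d → Matrix (Fin d) (Fin d) ℝ) (bV : 𝒜 → ℬ → Ed d → Ed d)
    (cF fF : 𝒜 → ℬ → Ed d → ℝ) (N : 𝒜 → ℬ → Ed d → Ed d → ℝ) (Ω : Set (Ed d))
    (u : Ed d → ℝ) : Prop :=
  ∀ φ : Ed d → ℝ, ContDiff ℝ 2 φ → IsBddFun φ → ∀ x ∈ Ω, (∀ y, φ y ≤ u y) → u x = φ x →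
    0 ≤ HJBIop aM bV cF fF N φ x

/-- Uniform ellipticity of the HJBI operator `ℐ`. -/
def UnifElliptic (lam Lam C0 : ℝ) (K : Ed d → ℝ) (Ω : Set (Ed d))
    (aM : 𝒜 → ℬ → Ed d → Matrix (Fin d) (Fin d) ℝ) (bV : 𝒜 → ℬ → Ed d → Ed d)
    (cF fF : 𝒜 → ℬ → Ed d → ℝ) (N : 𝒜 → ℬ → Ed d → Ed d → ℝ) : Prop :=
  ∃ m : ℝ → ℝ, IsModulus m ∧
    ∀ r s : ℝ, ∀ x ∈ Ω, ∀ φ ψ : Ed d → ℝ,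
      ContDiff ℝ 2 φ → IsBddFun φ → ContDiff ℝ 2 ψ → IsBddFun ψ →
      (pucciMinus lam Lam (hess (fun y => φ y - ψ y) x) + nlMinus K 1 (fun y => φ y - ψ y) x -
          C0 * ‖gradient (fun y => ψ y - φ y) x‖ - m |r - s| ≤
        HJBIat aM bV cF fF N ψ r x - HJBIat aM bV cF fF N φ s x) ∧
      (HJBIat aM bV cF fF N ψ r x - HJBIat aM bV cF fF N φ s x ≤
        pucciPlus lam Lam (hess (fun y => φ y - ψ y) x) + nlPlus K 1 (fun y => φ y - ψ y) x +
          C0 * ‖gradient (fun y => ψ y - φ y) x‖ + m |r - s|)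

/-- Boundedness of the coefficient families, uniformly in `a, b`. -/
def FamiliesBdd (Ω : Set (Ed d)) (aM : 𝒜 → ℬ → Ed d → Matrix (Fin d) (Fin d) ℝ)
    (bV : 𝒜 → ℬ → Ed d → Ed d) (cF fF : 𝒜 → ℬ → Ed d → ℝ) : Prop :=
  ∃ Cb : ℝ, ∀ a b, ∀ x ∈ Ω, (∀ i j, |aM a b x i j| ≤ Cb) ∧ ‖bV a b x‖ ≤ Cb ∧
      |cF a b x| ≤ Cb ∧ |fF a b x| ≤ Cb

/-- Uniform continuity of the coefficient families with a common modulus, uniformly in `a, b, z`. -/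
def FamiliesUC (Ω : Set (Ed d)) (aM : 𝒜 → ℬ → Ed d → Matrix (Fin d) (Fin d) ℝ)
    (bV : 𝒜 → ℬ → Ed d → Ed d) (cF fF : 𝒜 → ℬ → Ed d → ℝ)
    (N : 𝒜 → ℬ → Ed d → Ed d → ℝ) : Prop :=
  ∃ m₀ : ℝ → ℝ, IsModulus m₀ ∧ ∀ a b, ∀ x ∈ Ω, ∀ y ∈ Ω,
      (∀ i j, |aM a b x i j - aM a b y i j| ≤ m₀ ‖x - y‖) ∧
      ‖bV a b x - bV a b y‖ ≤ m₀ ‖x - y‖ ∧ |cF a b x - cF a b y| ≤ m₀ ‖x - y‖ ∧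
      |fF a b x - fF a b y| ≤ m₀ ‖x - y‖ ∧ ∀ z, |N a b x z - N a b y z| ≤ m₀ ‖x - y‖

end HJBI

/-- The quadratic test function. -/
def jetQ {d : ℕ} (x p e q : Ed d) (c b : ℝ) (y : Ed d) : ℝ :=
  c + ⟪p, y - x⟫ + 1/2 * (⟪e, y - x⟫ ^ 2 + ⟪q, y - x⟫ ^ 2 - b * ‖y - x‖ ^ 2)

lemma inner_sub_hasFDerivAt {d : ℕ} (a x y : Ed d) :
    HasFDerivAt (fun y : Ed d => ⟪a, y - x⟫) (innerSL ℝ a) y := by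
  have h0 : HasFDerivAt (fun y : Ed d => y - x) (ContinuousLinearMap.id ℝ (Ed d)) y :=
    (hasFDerivAt_id y).sub_const x
  have h : HasFDerivAt (fun w : Ed d => innerSL ℝ a w) (innerSL ℝ a) (y - x) :=
    (innerSL ℝ a).hasFDerivAt
  have := h.comp y h0
  rw [ContinuousLinearMap.comp_id] at this
  exact this

lemma jetQ_hasFDerivAt {d : ℕ} (x p e q : Ed d) (c b : ℝ) (y : Ed d) :
    HasFDerivAt (jetQ x p e q c b)
      (innerSL ℝ (p + ⟪e, y - x⟫ • e + ⟪q, y - x⟫ • q - b • (y - x))) y := by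
  have h0 : HasFDerivAt (fun y : Ed d => y - x) (ContinuousLinearMap.id ℝ (Ed d)) y :=
    (hasFDerivAt_id y).sub_const x
  have hin : ∀ a : Ed d, HasFDerivAt (fun y : Ed d => ⟪a, y - x⟫) (innerSL ℝ a) y := by
    exact fun a => inner_sub_hasFDerivAt a x y
  have hn : HasFDerivAt (fun y : Ed d => ‖y - x‖ ^ 2) (2 • (innerSL ℝ (y - x))) y := by
    have := h0.norm_sq
    simpa using this
  have := (((hin p).const_add c)).add
    (((((hin e).pow 2).add ((hin q).pow 2)).sub (hn.const_mul b)).const_mul (1/2))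
  refine this.congr_fderiv ?_
  ext v
  simp [innerSL_apply_apply]
  ring

lemma jetQ_contDiff {d : ℕ} (x p e q : Ed d) (c b : ℝ) : ContDiff ℝ 2 (jetQ x p e q c b) := by
  unfold jetQ
  have h0 : ContDiff ℝ 2 (fun y : Ed d => y - x) := contDiff_id.sub contDiff_const
  have hin : ∀ a : Ed d, ContDiff ℝ 2 (fun y : Ed d => ⟪a, y - x⟫) := fun a =>
    contDiff_const.inner ℝ h0
  exact (contDiff_const.add (hin p)).add (contDiff_const.mul ((((hin e).pow 2).add ((hin q).pow 2)).sub
    (contDiff_const.mul (h0.norm_sq ℝ))))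

lemma jetQ_gradient {d : ℕ} (x p e q : Ed d) (c b : ℝ) : gradient (jetQ x p e q c b) x = p := by
  have h := jetQ_hasFDerivAt x p e q c b x
  simp only [sub_self, inner_zero_right, zero_smul, add_zero, smul_zero, sub_zero] at h
  have : HasGradientAt (jetQ x p e q c b) p x := by
    rw [hasGradientAt_iff_hasFDerivAt]
    refine h.congr_fderiv ?_
    ext v; simp
  exact this.gradient

lemma jetQ_hess {d : ℕ} (x p e q : Ed d) (c b : ℝ) : hess (jetQ x p e q c b) x =
    Matrix.vecMulVec (fun i => e i) (fun i => e i) + Matrix.vecMulVec (fun i => q i) (fun i => q i)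
      - b • (1 : Matrix (Fin d) (Fin d) ℝ) := by
  ext i j
  have h1 : fderiv ℝ (jetQ x p e q c b) = fun y =>
      innerSL ℝ (p + ⟪e, y - x⟫ • e + ⟪q, y - x⟫ • q - b • (y - x)) := by
    ext1 y
    exact (jetQ_hasFDerivAt x p e q c b y).fderiv
  have h0 : HasFDerivAt (fun y : Ed d => y - x) (ContinuousLinearMap.id ℝ (Ed d)) x :=
    (hasFDerivAt_id x).sub_const x
  have hin : ∀ a : Ed d, HasFDerivAt (fun y : Ed d => ⟪a, y - x⟫) (innerSL ℝ a) x := by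
    exact fun a => inner_sub_hasFDerivAt a x x
  have hV : HasFDerivAt (fun y : Ed d => p + ⟪e, y - x⟫ • e + ⟪q, y - x⟫ • q - b • (y - x))
      ((innerSL ℝ e).smulRight e + (innerSL ℝ q).smulRight q - b • ContinuousLinearMap.id ℝ (Ed d)) x := by
    have := (((hin e).smul_const e).const_add p |>.add ((hin q).smul_const q)).sub (h0.const_smul b)
    exact this
  have h2 : HasFDerivAt (fderiv ℝ (jetQ x p e q c b)) ((innerSL ℝ : Ed d →L[ℝ] Ed d →L[ℝ] ℝ).comp
      ((innerSL ℝ e).smulRight e + (innerSL ℝ q).smulRight q - b • ContinuousLinearMap.id ℝ (Ed d))) x := by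
    rw [h1]
    exact ((innerSL ℝ : Ed d →L[ℝ] Ed d →L[ℝ] ℝ).hasFDerivAt).comp x hV
  unfold hess
  rw [Matrix.of_apply, iteratedFDeriv_two_apply, h2.fderiv]
  have hs : (innerSL ℝ (EuclideanSpace.single i (1 : ℝ) : Ed d)) (EuclideanSpace.single j 1)
      = if i = j then (1 : ℝ) else 0 := by
    change ⟪(EuclideanSpace.single i (1 : ℝ) : Ed d), EuclideanSpace.single j 1⟫ = _
    rw [EuclideanSpace.inner_single_left]
    simp [eq_comm]
  have he : ∀ (a : Ed d) (j : Fin d), (innerSL ℝ a) (EuclideanSpace.single j 1) = a j := by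
    intro a j
    change ⟪a, EuclideanSpace.single j (1 : ℝ)⟫ = _
    rw [EuclideanSpace.inner_single_right]; simp
  simp [Matrix.vecMulVec_apply, Matrix.one_apply, EuclideanSpace.inner_single_right, map_add, map_sub]
  simp only [he]
  by_cases hij : i = j
  · subst hij; simp
  · simp [hij, eq_comm]

lemma quad_lower {d : ℕ} {lam Lam : ℝ} {A : Matrix (Fin d) (Fin d) ℝ} (hA : A ∈ ellipticSet lam Lam d)
    (e : Ed d) : lam * ‖e‖ ^ 2 ≤ (A * Matrix.vecMulVec (fun i => e i) (fun i => e i)).trace := by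
  have h := hA.2.1.dotProduct_mulVec_nonneg (fun i => e i)
  have h2 : (A * Matrix.vecMulVec (fun i => e i) (fun i => e i)).trace
      = (fun i => e i) ⬝ᵥ (A.mulVec (fun i => e i)) := by
    rw [Matrix.mul_vecMulVec, Matrix.trace_vecMulVec, dotProduct_comm]
  have h3 : ‖e‖ ^ 2 = (fun i => e i) ⬝ᵥ (fun i => e i) := by
    rw [EuclideanSpace.real_norm_sq_eq]; simp [dotProduct, sq]
  rw [h2, h3]
  simp only [star_trivial, Matrix.sub_mulVec, dotProduct_sub, Matrix.smul_mulVec, Matrix.one_mulVec,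
    dotProduct_smul, smul_eq_mul] at h
  linarith

lemma pucci_lower {d : ℕ} {lam Lam : ℝ} (hLam : lam ≤ Lam) (e q : Ed d) (b : ℝ)
    (hb : 0 ≤ b) :
    lam * (‖e‖ ^ 2 + ‖q‖ ^ 2) - Lam * d * b ≤ pucciMinus lam Lam
      (Matrix.vecMulVec (fun i => e i) (fun i => e i) + Matrix.vecMulVec (fun i => q i) (fun i => q i)
      - b • (1 : Matrix (Fin d) (Fin d) ℝ)) := by
  unfold pucciMinus
  apply le_csInf
  · refine ⟨_, lam • (1 : Matrix (Fin d) (Fin d) ℝ), ⟨?_, ?_, ?_⟩, rfl⟩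
    · simp [Matrix.IsSymm]
    · simpa using Matrix.PosSemidef.zero
    · rw [← sub_smul]
      exact Matrix.PosSemidef.one.smul (by linarith)
  · rintro _ ⟨A, hA, rfl⟩
    have h1 := quad_lower hA e
    have h2 := quad_lower hA q
    have h3 := hA.2.2.trace_nonneg
    simp only [Matrix.trace_sub, Matrix.trace_smul, Matrix.trace_one, Fintype.card_fin, smul_eq_mul] at h3
    simp only [mul_sub, mul_add, Matrix.trace_sub, Matrix.trace_add, Matrix.mul_smul, mul_one, Matrix.trace_smul, smul_eq_mul]
    nlinarith

lemma smooth_below {d : ℕ} {u : Ed d → ℝ} (hu : Continuous u) {η : ℝ} (hη : 0 < η) :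
    ∃ G : Ed d → ℝ, ContDiff ℝ 2 G ∧ ∀ x, u x - η ≤ G x ∧ G x ≤ u x := by
  obtain ⟨g, h1, h2, -⟩ := (hu.sub continuous_const : Continuous fun x => u x - η/2).exists_contDiff_approx 2
    (ε := fun _ => η / 2) continuous_const (fun _ => by positivity)
  refine ⟨g, h1, fun x => ?_⟩
  have : dist (g x) (u x - η / 2) < η / 2 := h2 x
  rw [Real.dist_eq, abs_lt] at this
  constructor <;> linarith

set_option maxHeartbeats 1000000 in
lemma kernel_test {d : ℕ} {lam Lam C0 : ℝ} (hLam : lam ≤ Lam) {K : Ed d → ℝ} (hK : KernCond K)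
    {g u : Ed d → ℝ} {O : Set (Ed d)} (hu : Continuous u) (hbd : IsBddFun u)
    (hsup : SupersolMinus lam Lam C0 K g O u) {x p e q : Ed d} (hx : x ∈ O) {b s : ℝ} {L : Ed d → ℝ}
    (hs : 0 < s) (hs1 : s ≤ 1) (hb0 : 0 ≤ b)
    (htouch : ∀ z, ‖z‖ < s → u x + ⟪p, z⟫ + 1/2 * (⟪e, z⟫ ^ 2 + ⟪q, z⟫ ^ 2 - b * ‖z‖ ^ 2) ≤ u (x + z))
    (hL0 : ∀ z, 0 ≤ L z) (hLint : Integrable (fun z => L z * K z))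
    (hLb : ∀ z, ‖z‖ < s → b / 2 * ‖z‖ ^ 2 ≤ L z)
    (hLu : ∀ z, - L z ≤ u (x + z) - u x - (ball (0 : Ed d) 1).indicator (fun w => ⟪p, w⟫) z) :
    lam * (‖e‖ ^ 2 + ‖q‖ ^ 2) - Lam * d * b ≤ g x + (∫ z, L z * K z) + C0 * ‖p‖ := by
  apply le_of_forall_pos_le_add
  intro η' hη'
  obtain ⟨hKm, hK0, hKi⟩ := hK
  set I0 : ℝ := ∫ z, min (‖z‖ ^ 2) 1 * K z with hI0
  have hI0n : 0 ≤ I0 := integral_nonneg (fun z => mul_nonneg (le_min (sq_nonneg _) zero_le_one) (hK0 z))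
  set cs : ℝ := 4 / s ^ 2 with hcs
  have hcs0 : 0 < cs := by positivity
  set η : ℝ := η' / (cs * I0 + 1) with hη
  have hη0 : 0 < η := by positivity
  have hηle : η * (cs * I0) ≤ η' := by
    have h : η * (cs * I0 + 1) = η' := by rw [hη]; field_simp
    nlinarith
  obtain ⟨G, hGc, hG⟩ := smooth_below hu hη0
  let χ : ContDiffBump x := ⟨s / 2, s, by positivity, by linarith⟩
  set Q := jetQ x p e q (u x) b with hQ
  have hQx : Q x = u x := by simp [hQ, jetQ]
  have hQz : ∀ z, Q (x + z) = u x + ⟪p, z⟫ + 1/2 * (⟪e, z⟫ ^ 2 + ⟪q, z⟫ ^ 2 - b * ‖z‖ ^ 2) := by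
    intro z; simp [hQ, jetQ]
  have hQu : ∀ y, dist y x < s → Q y ≤ u y := by
    intro y hy
    have h := htouch (y - x) (by rwa [← dist_eq_norm])
    rw [← hQz] at h
    simpa using h
  set φ : Ed d → ℝ := fun y => χ y * Q y + (1 - χ y) * G y with hφ
  have hφc : ContDiff ℝ 2 φ := by
    have h1 : ContDiff ℝ 2 χ := χ.contDiff
    exact (h1.mul (jetQ_contDiff x p e q (u x) b)).add ((contDiff_const.sub h1).mul hGc)
  have hφu : ∀ y, φ y ≤ u y := by
    intro y
    have h0 := χ.nonneg (x := y)
    have h1 := χ.le_one (x := y)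
    have hg := (hG y).2
    by_cases hy : dist y x < s
    · have := hQu y hy
      simp only [hφ]; nlinarith
    · have : χ y = 0 := χ.zero_of_le_dist (not_lt.1 hy)
      simp [hφ, this, hg]
  have hφQ : ∀ y, dist y x ≤ s / 2 → φ y = Q y := by
    intro y hy
    have : χ y = 1 := χ.one_of_mem_closedBall hy
    simp [hφ, this]
  have hev : φ =ᶠ[nhds x] Q := by
    filter_upwards [closedBall_mem_nhds x (by positivity : 0 < s / 2)] with y hy
    exact hφQ y hy
  have hφx : φ x = u x := by rw [hev.eq_of_nhds, hQx]
  have hgrad : gradient φ x = p := by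
    rw [← jetQ_gradient x p e q (u x) b]
    unfold gradient
    rw [hev.fderiv_eq]
  have hhess : hess φ x = hess Q x := by
    unfold hess
    have := Filter.EventuallyEq.iteratedFDeriv ℝ hev 2
    rw [this.eq_of_nhds]
  have hφb : IsBddFun φ := by
    obtain ⟨M, hM⟩ := hbd
    have hQcont : Continuous Q := (jetQ_contDiff x p e q (u x) b).continuous
    obtain ⟨M2, hM2⟩ := (isCompact_closedBall x s).exists_bound_of_continuousOn hQcont.continuousOn
    refine ⟨|M2| + (|M| + η), fun y => ?_⟩
    have h0 := χ.nonneg (x := y)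
    have h1 := χ.le_one (x := y)
    have hGy : |G y| ≤ |M| + η := by
      have h3 := hG y
      have h4 := abs_le.1 ((hM y).trans (le_abs_self M))
      rw [abs_le]; constructor <;> linarith
    have hQy : |χ y * Q y| ≤ |M2| := by
      by_cases hy : dist y x < s
      · have h5 := (hM2 y (mem_closedBall.2 hy.le)).trans (le_abs_self M2)
        rw [Real.norm_eq_abs] at h5
        rw [abs_mul, abs_of_nonneg h0]
        nlinarith [abs_nonneg (Q y)]
      · have : χ y = 0 := χ.zero_of_le_dist (not_lt.1 hy)
        simp [this]
    have hGy2 : |(1 - χ y) * G y| ≤ |M| + η := by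
      rw [abs_mul, abs_of_nonneg (by linarith : 0 ≤ 1 - χ y)]
      nlinarith [abs_nonneg (G y)]
    exact (abs_add_le _ _).trans (add_le_add hQy hGy2)
  have key := hsup φ hφc hφb x hx hφu hφx.symm
  rw [hgrad, hhess, hQ, jetQ_hess] at key
  have hpu := pucci_lower hLam e q b hb0
  have hdelta : ∀ z, max (-deltaOp φ 1 x z) 0 ≤ L z + η * (cs * min (‖z‖ ^ 2) 1) := by
    intro z
    have hmin : 0 ≤ min (‖z‖ ^ 2) 1 := le_min (sq_nonneg _) zero_le_one
    refine max_le ?_ (add_nonneg (hL0 z) (mul_nonneg hη0.le (mul_nonneg hcs0.le hmin)))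
    unfold deltaOp
    rw [hφx, hgrad]
    simp only [div_one]
    by_cases hz : ‖z‖ ≤ s / 2
    · have hzs : ‖z‖ < s := by linarith
      have hball : z ∈ ball (0 : Ed d) 1 := by simp; linarith
      rw [hφQ (x + z) (by simpa using hz), hQz, indicator_of_mem hball]
      have := hLb z hzs
      have : 0 ≤ η * (cs * min (‖z‖ ^ 2) 1) := mul_nonneg hη0.le (mul_nonneg hcs0.le hmin)
      nlinarith [sq_nonneg ⟪e, z⟫, sq_nonneg ⟪q, z⟫]
    · push Not at hz
      have h1 : 1 ≤ cs * min (‖z‖ ^ 2) 1 := by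
        have h2 : s ^ 2 / 4 ≤ min (‖z‖ ^ 2) 1 := by
          apply le_min <;> nlinarith
        calc (1 : ℝ) = cs * (s ^ 2 / 4) := by rw [hcs]; field_simp
          _ ≤ _ := by gcongr
      have h3 : η ≤ η * (cs * min (‖z‖ ^ 2) 1) := by nlinarith
      have h4 := hLu z
      have hχ0 := χ.nonneg (x := x + z)
      have hχ1 := χ.le_one (x := x + z)
      have hGz := (hG (x + z)).1
      by_cases hzs : ‖z‖ < s
      · have hball : z ∈ ball (0 : Ed d) 1 := by simp; linarith
        rw [indicator_of_mem hball] at h4 ⊢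
        have h5 : u x + ⟪p, z⟫ - L z ≤ Q (x + z) := by
          rw [hQz]
          have := hLb z hzs
          nlinarith [sq_nonneg ⟪e, z⟫, sq_nonneg ⟪q, z⟫]
        have h6 : u x + ⟪p, z⟫ - L z - η ≤ φ (x + z) := by
          simp only [hφ]
          nlinarith
        linarith
      · have : χ (x + z) = 0 := χ.zero_of_le_dist (by simpa using (not_lt.1 hzs))
        have h6 : φ (x + z) = G (x + z) := by simp [hφ, this]
        rw [h6]; linarith
  have hnl : nlMinus K 1 φ x ≥ -(∫ z, L z * K z) - η' := by
    unfold nlMinus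
    have hKr : ∀ z, Kresc K 1 z = K z := by intro z; simp [Kresc]
    simp only [hKr]
    have h1 : ∫ z, max (-deltaOp φ 1 x z) 0 * K z ≤
        ∫ z, (L z * K z + η * cs * (min (‖z‖ ^ 2) 1 * K z)) := by
      apply integral_mono_of_nonneg
      · exact Filter.Eventually.of_forall fun z => mul_nonneg (le_max_right _ _) (hK0 z)
      · exact hLint.add (hKi.const_mul _)
      · refine Filter.Eventually.of_forall fun z => ?_
        have := mul_le_mul_of_nonneg_right (hdelta z) (hK0 z)
        simp only
        nlinarith
    rw [integral_add hLint (hKi.const_mul _), integral_const_mul] at h1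
    nlinarith
  linarith

/-- The scale `r` weight. -/
def omg {d : ℕ} (r : ℝ) (z : Ed d) : ℝ := min (‖z‖ ^ 2) (r * min ‖z‖ 1)

lemma omg_nonneg {d : ℕ} {r : ℝ} (hr : 0 ≤ r) (z : Ed d) : 0 ≤ omg r z :=
  le_min (sq_nonneg _) (mul_nonneg hr (le_min (norm_nonneg _) zero_le_one))

lemma omg_le {d : ℕ} {r : ℝ} (hr1 : r ≤ 1) (z : Ed d) : omg r z ≤ min (‖z‖ ^ 2) 1 := by
  unfold omg
  refine min_le_min le_rfl ?_
  have h0 : 0 ≤ min ‖z‖ 1 := le_min (norm_nonneg _) zero_le_one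
  have h1 : min ‖z‖ 1 ≤ 1 := min_le_right _ _
  nlinarith

lemma omg_cont {d : ℕ} (r : ℝ) : Continuous (omg (d := d) r) := by
  unfold omg
  fun_prop

lemma omg_integrable {d : ℕ} {K : Ed d → ℝ} (hK : KernCond K) {r : ℝ} (hr : 0 ≤ r) (hr1 : r ≤ 1) :
    Integrable (fun z => omg r z * K z) := by
  obtain ⟨hKm, hK0, hKi⟩ := hK
  refine hKi.mono' ((omg_cont r).measurable.mul hKm).aestronglyMeasurable ?_
  refine Filter.Eventually.of_forall fun z => ?_
  rw [Real.norm_eq_abs, abs_of_nonneg (mul_nonneg (omg_nonneg hr z) (hK0 z))]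
  exact mul_le_mul_of_nonneg_right (omg_le hr1 z) (hK0 z)

lemma omg_small {d : ℕ} {K : Ed d → ℝ} (hK : KernCond K) {ε : ℝ} (hε : 0 < ε) :
    ∃ r0 : ℝ, 0 < r0 ∧ r0 ≤ 1 ∧ ∀ r, 0 < r → r ≤ r0 → ∫ z, omg r z * K z ≤ ε := by
  have hlim : Filter.Tendsto (fun n : ℕ => ∫ z, omg (1 / ((n : ℝ) + 1)) z * K z) Filter.atTop
      (nhds (∫ _z : Ed d, (0 : ℝ))) := by
    have hn1 : ∀ n : ℕ, 1 / ((n : ℝ) + 1) ≤ 1 := fun n => by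
      rw [div_le_one (by positivity)]; linarith [(Nat.cast_nonneg n : (0 : ℝ) ≤ n)]
    have hn0 : ∀ n : ℕ, 0 ≤ 1 / ((n : ℝ) + 1) := fun n => by positivity
    apply tendsto_integral_of_dominated_convergence (fun z => min (‖z‖ ^ 2) 1 * K z)
    · exact fun n => (omg_integrable hK (hn0 n) (hn1 n)).aestronglyMeasurable
    · exact hK.2.2
    · intro n
      refine Filter.Eventually.of_forall fun z => ?_
      rw [Real.norm_eq_abs, abs_of_nonneg (mul_nonneg (omg_nonneg (hn0 n) z) (hK.2.1 z))]
      exact mul_le_mul_of_nonneg_right (omg_le (hn1 n) z) (hK.2.1 z)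
    · refine Filter.Eventually.of_forall fun z => ?_
      have h1 : Filter.Tendsto (fun n : ℕ => 1 / ((n : ℝ) + 1) * K z) Filter.atTop (nhds 0) := by
        simpa using tendsto_one_div_add_atTop_nhds_zero_nat.mul_const (K z)
      refine squeeze_zero (fun n => mul_nonneg (omg_nonneg (hn0 n) z) (hK.2.1 z)) (fun n => ?_) h1
      refine mul_le_mul_of_nonneg_right ?_ (hK.2.1 z)
      refine (min_le_right _ _).trans ?_
      have h1 : min ‖z‖ 1 ≤ 1 := min_le_right _ _
      nlinarith [hn0 n]
  rw [integral_zero] at hlim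
  obtain ⟨n, hn⟩ := (hlim.eventually (gt_mem_nhds hε)).exists
  refine ⟨1 / ((n : ℝ) + 1), by positivity, ?_, fun r hr hrn => ?_⟩
  · rw [div_le_one (by positivity)]; linarith [(Nat.cast_nonneg n : (0 : ℝ) ≤ n)]
  · refine le_trans ?_ hn.le
    have hn1 : 1 / ((n : ℝ) + 1) ≤ 1 := by
      rw [div_le_one (by positivity)]; linarith [(Nat.cast_nonneg n : (0 : ℝ) ≤ n)]
    apply integral_mono (omg_integrable hK hr.le (hrn.trans hn1)) (omg_integrable hK (by positivity) hn1)
    intro z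
    refine mul_le_mul_of_nonneg_right ?_ (hK.2.1 z)
    unfold omg
    exact min_le_min le_rfl (mul_le_mul_of_nonneg_right hrn (le_min (norm_nonneg _) zero_le_one))

/-- Kernel-free second order jet inequality. -/
def JetSup {d : ℕ} (lam LD ε : ℝ) (g : Ed d → ℝ) (R : ℝ) (w : Ed d → ℝ) : Prop :=
  ∀ x : Ed d, ‖x‖ < R → ∀ (p e q : Ed d) (b s A : ℝ), 0 < s → s ≤ 1 → 0 ≤ b → b ≤ A → 1 ≤ A →
    (∀ z, ‖z‖ < s → w x + ⟪p, z⟫ + 1/2 * (⟪e, z⟫ ^ 2 + ⟪q, z⟫ ^ 2 - b * ‖z‖ ^ 2) ≤ w (x + z)) →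
    (∀ z, -(A * min (‖z‖ ^ 2) ‖z‖) ≤
      w (x + z) - w x - (ball (0 : Ed d) 1).indicator (fun v => ⟪p, v⟫) z) →
    lam * (‖e‖ ^ 2 + ‖q‖ ^ 2) - LD * b ≤ g x + ε * (A + ‖p‖)

set_option maxHeartbeats 1000000 in
lemma jetSup_rescale {d : ℕ} {lam Lam C0 ε : ℝ} (hLam : lam ≤ Lam) (hC0 : 0 ≤ C0)
    {K : Ed d → ℝ} (hK : KernCond K) {g u : Ed d → ℝ} (hu : Continuous u)
    (hbd : ∀ x, u x ∈ Icc (-(1/2) : ℝ) (1/2))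
    (hsup : SupersolMinus lam Lam C0 K g (ball 0 1) u)
    {r H R m : ℝ} {x0 : Ed d} (hr : 0 < r) (hr1 : r ≤ 1) (hH : r ≤ H)
    (hε : (∫ z, omg r z * K z) + C0 * r ≤ ε)
    (hball : ∀ y : Ed d, ‖y‖ < R → x0 + r • y ∈ ball (0 : Ed d) 1) :
    JetSup lam (Lam * d) ε (fun y => r ^ 2 / H * g (x0 + r • y)) R
      (fun y => (u (x0 + r • y) - m) / H) := by
  intro x hx p e q b s A hs hs1 hb0 hbA hA1 htouch hA
  have hH0 : 0 < H := hr.trans_le hH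
  set X := x0 + r • x with hX
  set a : ℝ := H / r ^ 2 with ha
  have ha0 : 0 < a := by positivity
  have hpn := norm_nonneg p
  have hAp : 0 ≤ A + ‖p‖ := by linarith
  -- transfer
  have hshift : ∀ z : Ed d, x0 + r • (x + r⁻¹ • z) = X + z := by
    intro z
    rw [smul_add, smul_smul, mul_inv_cancel₀ hr.ne', one_smul, hX, add_assoc]
  have hnz : ∀ z : Ed d, ‖r⁻¹ • z‖ = ‖z‖ / r := by
    intro z
    rw [norm_smul, Real.norm_eq_abs, abs_of_pos (inv_pos.2 hr)]; field_simp
  have hiz : ∀ v z : Ed d, ⟪v, r⁻¹ • z⟫ = ⟪v, z⟫ / r := by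
    intro v z
    rw [inner_smul_right]; field_simp
  set L : Ed d → ℝ := fun z => a * (A + ‖p‖) * omg r z with hL
  have hsq : Real.sqrt a ^ 2 = a := Real.sq_sqrt ha0.le
  have key := kernel_test (C0 := C0) hLam hK hu ⟨1/2, fun x => abs_le.2 (hbd x)⟩ hsup (x := X)
    (p := (H / r) • p) (e := Real.sqrt a • e) (q := Real.sqrt a • q) (b := a * b) (s := r * s) (L := L)
    (hball x hx) (by positivity) (by nlinarith) (by positivity) ?_ ?_ ?_ ?_ ?_
  · rw [norm_smul, norm_smul, norm_smul, Real.norm_eq_abs, Real.norm_eq_abs, mul_pow, mul_pow, sq_abs, hsq,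
      abs_of_pos (by positivity)] at key
    have hLi : ∫ z, L z * K z = a * (A + ‖p‖) * ∫ z, omg r z * K z := by
      rw [← integral_const_mul]
      congr 1; ext z; simp only [hL]; ring
    rw [hLi] at key
    have h1 : H / r = a * r := by rw [ha]; field_simp
    have h2 : r ^ 2 / H * a = 1 := by rw [ha]; field_simp
    have h3 : a * (lam * (‖e‖ ^ 2 + ‖q‖ ^ 2) - Lam * d * b) ≤
        a * (r ^ 2 / H * g X + ε * (A + ‖p‖)) := by
      have h4 : a * (r ^ 2 / H * g X + ε * (A + ‖p‖)) = g X + a * (A + ‖p‖) * ε := by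
        linear_combination (g X) * h2
      rw [h4]
      rw [h1] at key
      have h5 : a * (A + ‖p‖) * ((∫ z, omg r z * K z) + C0 * r) ≤ a * (A + ‖p‖) * ε := by
        gcongr
      have h6 : 0 ≤ a * A * (C0 * r) := by positivity
      nlinarith
    exact le_of_mul_le_mul_left h3 ha0
  · intro z hz
    have h := htouch (r⁻¹ • z) (by rw [hnz, div_lt_iff₀ hr]; linarith)
    simp only [hshift, hiz, hnz] at h
    have h1 : u X + H * (⟪p, z⟫ / r + 1/2 * ((⟪e, z⟫ / r) ^ 2 + (⟪q, z⟫ / r) ^ 2 - b * (‖z‖ / r) ^ 2))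
        ≤ u (X + z) := by
      have h2 := mul_le_mul_of_nonneg_left h hH0.le
      have h3 : H * ((u (X + z) - m) / H) = u (X + z) - m := by field_simp
      have h4 : H * ((u X - m) / H) = u X - m := by field_simp
      rw [h3, mul_add, mul_add, h4] at h2
      linarith
    refine le_trans (le_of_eq ?_) h1
    rw [inner_smul_left, inner_smul_left, inner_smul_left, mul_pow, mul_pow]
    simp only [conj_trivial]
    rw [hsq, ha]
    field_simp
    ring
  · exact fun z => mul_nonneg (mul_nonneg ha0.le hAp) (omg_nonneg hr.le z)
  · have := (omg_integrable hK hr.le hr1).const_mul (a * (A + ‖p‖))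
    refine this.congr (Filter.Eventually.of_forall fun z => ?_)
    simp only [hL]; ring
  · intro z hz
    have hzr : ‖z‖ < r := by nlinarith
    have h1 : omg r z = ‖z‖ ^ 2 := by
      unfold omg
      rw [min_eq_left (by linarith : ‖z‖ ≤ 1)]
      apply min_eq_left
      nlinarith [norm_nonneg z]
    simp only [hL, h1]
    have : a * b / 2 ≤ a * (A + ‖p‖) := by nlinarith
    exact mul_le_mul_of_nonneg_right this (sq_nonneg _)
  · intro z
    have h := hA (r⁻¹ • z)
    simp only [hshift, hnz] at h
    have hzn := norm_nonneg z
    have hd : (u (X + z) - m) / H - (u X - m) / H = (u (X + z) - u X) / H := by ring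
    rw [← hX, hd] at h
    by_cases hz1 : ‖z‖ < r
    · have hm1 : r⁻¹ • z ∈ ball (0 : Ed d) 1 := by
        rw [mem_ball_zero_iff, hnz, div_lt_one hr]; exact hz1
      have hm2 : z ∈ ball (0 : Ed d) 1 := by rw [mem_ball_zero_iff]; linarith
      rw [indicator_of_mem hm1, hiz] at h
      rw [indicator_of_mem hm2, inner_smul_left]
      have h1 : omg r z = ‖z‖ ^ 2 := by
        unfold omg
        rw [min_eq_left (by linarith : ‖z‖ ≤ 1)]
        apply min_eq_left
        nlinarith [norm_nonneg z]
      have h2 : A * min ((‖z‖ / r) ^ 2) (‖z‖ / r) ≤ A * (‖z‖ / r) ^ 2 :=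
        mul_le_mul_of_nonneg_left (min_le_left _ _) (by linarith)
      have h3 : -(A * (‖z‖ / r) ^ 2) * H ≤ ((u (X + z) - u X) / H - ⟪p, z⟫ / r) * H := by
        apply mul_le_mul_of_nonneg_right _ hH0.le; linarith
      have h4 : ((u (X + z) - u X) / H - ⟪p, z⟫ / r) * H = u (X + z) - u X - (H / r) * ⟪p, z⟫ := by
        field_simp
      have h5 : (A * (‖z‖ / r) ^ 2) * H = a * A * ‖z‖ ^ 2 := by rw [ha]; field_simp
      simp only [hL, h1, conj_trivial]
      have h6 : 0 ≤ a * ‖p‖ * ‖z‖ ^ 2 := by positivity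
      rw [h4] at h3
      nlinarith
    · push Not at hz1
      have hm1 : r⁻¹ • z ∉ ball (0 : Ed d) 1 := by
        rw [mem_ball_zero_iff, hnz, div_lt_one hr]; exact not_lt.2 hz1
      rw [indicator_of_notMem hm1] at h
      by_cases hz2 : ‖z‖ < 1
      · have hm2 : z ∈ ball (0 : Ed d) 1 := by rw [mem_ball_zero_iff]; linarith
        rw [indicator_of_mem hm2, inner_smul_left]
        have h1 : omg r z = r * ‖z‖ := by
          unfold omg
          rw [min_eq_left hz2.le]
          apply min_eq_right
          nlinarith
        have h2 : A * min ((‖z‖ / r) ^ 2) (‖z‖ / r) ≤ A * (‖z‖ / r) :=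
          mul_le_mul_of_nonneg_left (min_le_right _ _) (by linarith)
        have h3 : -(A * (‖z‖ / r)) * H ≤ ((u (X + z) - u X) / H) * H := by
          apply mul_le_mul_of_nonneg_right _ hH0.le; linarith
        have h4 : ((u (X + z) - u X) / H) * H = u (X + z) - u X := by
          field_simp
        have h5 : (A * (‖z‖ / r)) * H = a * A * (r * ‖z‖) := by rw [ha]; field_simp
        have h6 : H / r * ⟪p, z⟫ ≤ a * ‖p‖ * (r * ‖z‖) := by
          have : a * ‖p‖ * (r * ‖z‖) = H / r * (‖p‖ * ‖z‖) := by rw [ha]; field_simp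
          rw [this]
          exact mul_le_mul_of_nonneg_left (real_inner_le_norm p z) (by positivity)
        simp only [hL, h1, conj_trivial]
        rw [h4] at h3
        nlinarith
      · push Not at hz2
        have hm2 : z ∉ ball (0 : Ed d) 1 := by rw [mem_ball_zero_iff]; exact not_lt.2 hz2
        rw [indicator_of_notMem hm2]
        have h1 : omg r z = r := by
          unfold omg
          rw [min_eq_right hz2, mul_one]
          apply min_eq_right
          nlinarith
        simp only [hL, h1]
        have h2 : 1 ≤ a * r := by
          have : a * r = H / r := by rw [ha]; field_simp
          rw [this, le_div_iff₀ hr]; linarith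
        have h3 := (hbd (X + z)).1
        have h4 := (hbd X).2
        nlinarith


lemma scalar_ineq {t r L n : ℝ} (hr : 0 < r) (hL : 2 ≤ L) (htn : |t| ≤ n) (hn1 : L * r ≤ n)
    (hn2 : n ≤ 2 * L * r) :
    t ^ 2 / (6 * L) + r * t / 3 - n ^ 2 / (2 * L ^ 2) < max 0 (r * (t - r)) := by
  have hL0 : 0 < L := by linarith
  have h1 : r ^ 2 / 2 ≤ n ^ 2 / (2 * L ^ 2) := by
    rw [div_le_div_iff₀ (by norm_num) (by positivity)]
    have := pow_le_pow_left₀ (by positivity) hn1 2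
    nlinarith
  have hr2 : 0 < r ^ 2 := by positivity
  obtain ⟨ht1, ht2⟩ := abs_le.1 htn
  rcases le_or_gt t 0 with h0 | h0
  · apply lt_max_of_lt_left
    have : t ^ 2 / (6 * L) ≤ -(r * t / 3) := by
      rw [div_le_iff₀ (by positivity)]
      nlinarith
    linarith
  rcases le_or_gt t (2 * r) with h2 | h2
  · have h3 : t ^ 2 / (6 * L) ≤ t ^ 2 / 12 := by
      apply div_le_div_of_nonneg_left (by positivity) (by norm_num) (by linarith)
    rcases le_or_gt t r with h4 | h4
    · apply lt_max_of_lt_left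
      nlinarith
    · apply lt_max_of_lt_right
      nlinarith [mul_nonneg (sub_nonneg.2 h4.le) (sub_nonneg.2 h2)]
  · apply lt_max_of_lt_right
    have : t ^ 2 / (6 * L) ≤ r * t / 3 := by
      rw [div_le_iff₀ (by positivity)]
      nlinarith
    nlinarith

lemma contact_geom {d : ℕ} {v : Ed d → ℝ} (hv : Continuous v) {x p D : Ed d} {r L : ℝ} (hr : 0 < r)
    (hL : 2 ≤ L) (hLr : 2 * L * r ≤ 1) (hD : D ≠ 0)
    (h1 : ∀ y, ‖y - x‖ ≤ 1 → v x + ⟪p, y - x⟫ ≤ v y)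
    (h2 : ∀ y, ‖y - x‖ ≤ 1 → v x + ⟪p, y - x⟫ + ⟪D, y - x⟫ - ‖D‖ * r ≤ v y) :
    ∃ xs π e : Ed d, ‖xs - x‖ < L * r ∧ ‖π‖ ≤ 2 * ‖D‖ ∧ ‖e‖ ^ 2 = ‖D‖ / r / (3 * L) ∧
      v xs ≤ v x + ⟪p, xs - x⟫ + ‖D‖ * r * L ∧
      ∀ z, ‖z‖ < L * r → v xs + ⟪p + π, z⟫ + 1/2 * (⟪e, z⟫ ^ 2 - ‖D‖ / r / L ^ 2 * ‖z‖ ^ 2) ≤ v (xs + z) := by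
  have hm : 0 < ‖D‖ := norm_pos_iff.2 hD
  have hL0 : 0 < L := by linarith
  set m := ‖D‖ with hmdef
  set τ := m / r with hτ
  have hτ0 : 0 < τ := by positivity
  have hmτ : m = τ * r := by rw [hτ]; field_simp
  set E : Ed d := m⁻¹ • D with hE
  have hEn : ‖E‖ = 1 := by
    rw [hE, norm_smul, norm_inv, Real.norm_eq_abs, abs_of_pos hm, inv_mul_cancel₀ hm.ne']
  have hDE : ∀ y, ⟪D, y⟫ = m * ⟪E, y⟫ := by
    intro y; rw [hE, inner_smul_left]; simp only [conj_trivial]; field_simp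
  clear_value E
  set P : Ed d → ℝ := fun y => τ * (⟪E, y - x⟫ ^ 2 / (6 * L) + r * ⟪E, y - x⟫ / 3 - ‖y - x‖ ^ 2 / (2 * L ^ 2))
    with hP
  set Q : Ed d → ℝ := fun y => v y - v x - ⟪p, y - x⟫ - P y with hQ
  have hQc : Continuous Q := by
    simp only [hQ, hP]; fun_prop
  have hne : (closedBall x (2 * L * r)).Nonempty := nonempty_closedBall.2 (by positivity)
  obtain ⟨xs, hxs, hmin⟩ := (isCompact_closedBall x (2 * L * r)).exists_isMinOn hne hQc.continuousOn
  have hQx : Q x = 0 := by simp [hQ, hP]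
  have hQs : Q xs ≤ 0 := by
    rw [← hQx]; exact hmin (mem_closedBall_self (by positivity))
  rw [mem_closedBall, dist_eq_norm] at hxs
  have hip : |⟪E, xs - x⟫| ≤ ‖xs - x‖ := by
    have := abs_real_inner_le_norm E (xs - x)
    rwa [hEn, one_mul] at this
  have hlt : ‖xs - x‖ < L * r := by
    by_contra hcon
    push Not at hcon
    have hs := scalar_ineq hr hL hip hcon hxs
    have hs' := mul_lt_mul_of_pos_left hs hτ0
    have ha := h1 xs (by linarith)
    have hb := h2 xs (by linarith)
    rw [hDE, hmτ] at hb
    simp only [hQ, hP] at hQs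
    rcases max_cases 0 (r * (⟪E, xs - x⟫ - r)) with ⟨h, -⟩ | ⟨h, -⟩
    · rw [h] at hs'; linarith
    · rw [h] at hs'; linarith
  set t := ⟪E, xs - x⟫ with ht
  have htL : |t| ≤ L * r := hip.trans hlt.le
  obtain ⟨htl, htu⟩ := abs_le.1 htL
  refine ⟨xs, (τ * (t / (3 * L) + r / 3)) • E - (τ / L ^ 2) • (xs - x), Real.sqrt (τ / (3 * L)) • E, hlt, ?_, ?_, ?_, ?_⟩
  · refine (norm_sub_le _ _).trans ?_
    rw [norm_smul, norm_smul, hEn, mul_one, Real.norm_eq_abs, Real.norm_eq_abs, abs_mul, abs_of_pos hτ0,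
      abs_of_pos (by positivity : 0 < τ / L ^ 2)]
    have ha : |t / (3 * L) + r / 3| ≤ r := by
      have : |t / (3 * L)| ≤ r / 3 := by
        rw [abs_div, abs_of_pos (by positivity : 0 < 3 * L), div_le_iff₀ (by positivity)]
        linarith
      refine (abs_add_le _ _).trans ?_
      rw [abs_of_pos (by positivity : 0 < r / 3)]
      linarith
    have hb : τ / L ^ 2 * ‖xs - x‖ ≤ τ * r := by
      rw [div_mul_eq_mul_div, div_le_iff₀ (by positivity)]
      have h5 : τ * ‖xs - x‖ ≤ τ * (L * r) := mul_le_mul_of_nonneg_left hlt.le hτ0.le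
      have h6 : L * (τ * r) ≤ L ^ 2 * (τ * r) := mul_le_mul_of_nonneg_right (by nlinarith) (by positivity)
      linarith
    have hc := mul_le_mul_of_nonneg_left ha hτ0.le
    rw [hmτ]; linarith
  · rw [norm_smul, hEn, mul_one, Real.norm_eq_abs, sq_abs, Real.sq_sqrt (by positivity)]
  · have h3 : P xs ≤ m * r * L := by
      simp only [hP]
      rw [← ht, hmτ]
      have h4 : t ^ 2 / (6 * L) ≤ r ^ 2 * L / 6 := by
        rw [div_le_iff₀ (by positivity)]
        nlinarith
      have h5 : 0 ≤ ‖xs - x‖ ^ 2 / (2 * L ^ 2) := by positivity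
      have h6 : r * t / 3 ≤ r * (L * r) / 3 := by gcongr
      have h7 : 0 < r ^ 2 * L := by positivity
      have h8 : t ^ 2 / (6 * L) + r * t / 3 - ‖xs - x‖ ^ 2 / (2 * L ^ 2) ≤ r ^ 2 * L := by nlinarith
      have := mul_le_mul_of_nonneg_left h8 hτ0.le
      linarith
    simp only [hQ] at hQs
    linarith
  · intro z hz
    have h3 : Q xs ≤ Q (xs + z) := by
      apply hmin
      rw [mem_closedBall, dist_eq_norm, show xs + z - x = (xs - x) + z by abel]
      exact (norm_add_le _ _).trans (by linarith)
    have hexp : xs + z - x = (xs - x) + z := by abel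
    have h4 : P (xs + z) = P xs + ⟪(τ * (t / (3 * L) + r / 3)) • E - (τ / L ^ 2) • (xs - x), z⟫
        + 1/2 * (⟪Real.sqrt (τ / (3 * L)) • E, z⟫ ^ 2 - τ / L ^ 2 * ‖z‖ ^ 2) := by
      have h5 : ⟪(τ * (t / (3 * L) + r / 3)) • E - (τ / L ^ 2) • (xs - x), z⟫
          = (τ * (t / (3 * L) + r / 3)) * ⟪E, z⟫ - (τ / L ^ 2) * ⟪xs - x, z⟫ := by
        rw [inner_sub_left, inner_smul_left, inner_smul_left]; simp only [conj_trivial]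
      have h6 : ⟪Real.sqrt (τ / (3 * L)) • E, z⟫ ^ 2 = τ / (3 * L) * ⟪E, z⟫ ^ 2 := by
        rw [inner_smul_left, mul_pow]; simp only [conj_trivial]
        rw [Real.sq_sqrt (by positivity)]
      rw [h5, h6]
      simp only [hP]
      rw [hexp, inner_add_right, norm_add_sq_real, ← ht]
      field_simp
      ring
    simp only [hQ] at h3
    rw [h4, hexp, inner_add_right] at h3
    rw [inner_add_left]
    linarith

/-- the bump used as a barrier -/
def bmp {d : ℕ} (κ N : ℝ) (x : Ed d) : ℝ := N * Real.exp (-κ * ‖x‖ ^ 2)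

lemma bmp_cont {d : ℕ} (κ N : ℝ) : Continuous (bmp (d := d) κ N) := by unfold bmp; fun_prop

lemma bmp_pos {d : ℕ} {κ N : ℝ} (hN : 0 < N) (x : Ed d) : 0 < bmp κ N x := by unfold bmp; positivity

lemma bmp_le {d : ℕ} {κ N : ℝ} (hκ : 0 ≤ κ) (hN : 0 < N) (x : Ed d) : bmp κ N x ≤ N := by
  unfold bmp
  have : Real.exp (-κ * ‖x‖ ^ 2) ≤ 1 := Real.exp_le_one_iff.2 (by nlinarith [mul_nonneg hκ (sq_nonneg ‖x‖)])
  nlinarith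

lemma bmp_add {d : ℕ} (κ N : ℝ) (x z : Ed d) :
    bmp κ N (x + z) = bmp κ N x * Real.exp (-2 * κ * ⟪x, z⟫ - κ * ‖z‖ ^ 2) := by
  unfold bmp
  rw [mul_assoc, ← Real.exp_add, norm_add_sq_real]
  congr 2; ring

lemma bmp_global {d : ℕ} {κ N : ℝ} (hN : 0 < N) (x z : Ed d) :
    bmp κ N x * (-2 * κ * ⟪x, z⟫ - κ * ‖z‖ ^ 2) ≤ bmp κ N (x + z) - bmp κ N x := by
  rw [bmp_add]
  have := Real.add_one_le_exp (-2 * κ * ⟪x, z⟫ - κ * ‖z‖ ^ 2)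
  nlinarith [bmp_pos (κ := κ) hN x]

lemma bmp_local {d : ℕ} {κ N η : ℝ} (hκ : 1 ≤ κ) (hN : 0 < N) (hη : 0 < η) :
    ∃ s > 0, s ≤ 1 ∧ ∀ x z : Ed d, ‖x‖ ≤ 5 → ‖z‖ < s →
    bmp κ N x * (-2 * κ * ⟪x, z⟫ - κ * ‖z‖ ^ 2 + 2 * κ ^ 2 * ⟪x, z⟫ ^ 2) - η * ‖z‖ ^ 2
      ≤ bmp κ N (x + z) - bmp κ N x := by
  set C := 10 * κ ^ 2 + 11 ^ 3 * κ ^ 3 with hC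
  have hC0 : 0 < C := by positivity
  refine ⟨min (1 / (11 * κ)) (η / (N * C)), lt_min (by positivity) (by positivity), ?_, ?_⟩
  · refine (min_le_left _ _).trans ?_
    rw [div_le_one (by positivity)]; linarith
  intro x z hx hz
  have hz1 : ‖z‖ < 1 / (11 * κ) := hz.trans_le (min_le_left _ _)
  have hz2 : ‖z‖ < η / (N * C) := hz.trans_le (min_le_right _ _)
  rw [lt_div_iff₀ (by positivity)] at hz1 hz2
  have hzn := norm_nonneg z
  have hz3 : ‖z‖ ≤ 1 := by nlinarith
  set y := -2 * κ * ⟪x, z⟫ - κ * ‖z‖ ^ 2 with hy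
  have hi : |⟪x, z⟫| ≤ 5 * ‖z‖ := (abs_real_inner_le_norm x z).trans (by gcongr)
  obtain ⟨hi1, hi2⟩ := abs_le.1 hi
  have hyb : |y| ≤ 11 * κ * ‖z‖ := by
    have hsq : κ * ‖z‖ ^ 2 ≤ κ * ‖z‖ := by
      apply mul_le_mul_of_nonneg_left _ (by linarith); nlinarith
    have h1 := mul_le_mul_of_nonneg_left hi1 (by linarith : 0 ≤ κ)
    have h2 := mul_le_mul_of_nonneg_left hi2 (by linarith : 0 ≤ κ)
    have h3 : 0 ≤ κ * ‖z‖ ^ 2 := by positivity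
    rw [abs_le]; constructor <;> rw [hy] <;> nlinarith
  have hy1 : |y| ≤ 1 := by nlinarith
  have hb := Real.exp_bound hy1 (n := 3) (by norm_num)
  have hb2 : 1 + y + y ^ 2 / 2 - |y| ^ 3 ≤ Real.exp y := by
    have h1 := (abs_le.1 hb).1
    simp [Finset.sum_range_succ, Nat.factorial] at h1
    have h2 : 0 ≤ |y| ^ 3 := by positivity
    norm_num at h1
    linarith
  have hy3 : |y| ^ 3 ≤ 11 ^ 3 * κ ^ 3 * ‖z‖ ^ 3 := by
    have := pow_le_pow_left₀ (abs_nonneg y) hyb 3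
    calc |y| ^ 3 ≤ _ := this
      _ = _ := by ring
  have hy2 : 2 * κ ^ 2 * ⟪x, z⟫ ^ 2 - 10 * κ ^ 2 * ‖z‖ ^ 3 ≤ y ^ 2 / 2 := by
    have h1 : y ^ 2 / 2 = 2 * κ ^ 2 * ⟪x, z⟫ ^ 2 + 2 * κ ^ 2 * ‖z‖ ^ 2 * ⟪x, z⟫ + κ ^ 2 * ‖z‖ ^ 4 / 2 := by
      rw [hy]; ring
    have h2 : 2 * κ ^ 2 * ‖z‖ ^ 2 * (-(5 * ‖z‖)) ≤ 2 * κ ^ 2 * ‖z‖ ^ 2 * ⟪x, z⟫ :=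
      mul_le_mul_of_nonneg_left hi1 (by positivity)
    have h3 : 0 ≤ κ ^ 2 * ‖z‖ ^ 4 / 2 := by positivity
    rw [h1]; nlinarith
  have hfin : y + 2 * κ ^ 2 * ⟪x, z⟫ ^ 2 - C * ‖z‖ ^ 3 ≤ Real.exp y - 1 := by
    rw [hC]; nlinarith
  rw [bmp_add, ← hy]
  set G := bmp κ N x with hG
  have hGp : 0 < G := bmp_pos hN x
  have hGN : G ≤ N := bmp_le (by linarith) hN x
  have h1 := mul_le_mul_of_nonneg_left hfin hGp.le
  have h2 : G * (C * ‖z‖ ^ 3) ≤ η * ‖z‖ ^ 2 := by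
    calc G * (C * ‖z‖ ^ 3) ≤ N * (C * ‖z‖ ^ 3) := mul_le_mul_of_nonneg_right hGN (by positivity)
      _ = (‖z‖ * (N * C)) * ‖z‖ ^ 2 := by ring
      _ ≤ η * ‖z‖ ^ 2 := mul_le_mul_of_nonneg_right hz2.le (by positivity)
  nlinarith


/-- contact pairs for the barrier-modified function -/
def Contact {d : ℕ} (κ N : ℝ) (w : Ed d → ℝ) (x p : Ed d) : Prop :=
  ‖p‖ ≤ 1/20 ∧ ‖x‖ < 4 ∧ w x < N ∧
    ∀ y, ‖y‖ ≤ 6 → w x - bmp κ N x + ⟪p, y - x⟫ ≤ w y - bmp κ N y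

set_option maxHeartbeats 1000000 in
lemma contact_core {d : ℕ} {lam LD κ N L ε : ℝ} (hlam : 0 < lam) (hLD : 0 ≤ LD) (hκ : 1 ≤ κ) (hN : 0 < N)
    (hL : 2 ≤ L) (hLL : 6 * LD ≤ lam * L) (hε : 0 ≤ ε) {w g : Ed d → ℝ} (hw : Continuous w)
    (hw4 : ∀ y, -(4 * ‖y‖) ≤ w y) (hJ : JetSup lam LD ε g 5 w) {x p x' p' : Ed d}
    (hc : Contact κ N w x p) (hc' : Contact κ N w x' p') (hpp : p' ≠ p) {r η : ℝ} (hr : 0 < r)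
    (hLr : 2 * L * r ≤ 1) (hxx : ‖x' - x‖ ≤ r) (hη : 0 < η) (hη1 : η ≤ 1) :
    ∃ xs, ‖xs - x‖ < L * r ∧
      (lam / (6 * L) - 4 * ε) * (‖p' - p‖ / r) + bmp κ N xs * (4 * κ ^ 2 * lam * ‖xs‖ ^ 2 - 2 * κ * LD)
        - 2 * η * LD ≤ g xs + ε * (12 * κ * N + 2 * N + 28) := by
  obtain ⟨hp1, hx4, hwx, hcon⟩ := hc
  obtain ⟨hp1', hx4', hwx', hcon'⟩ := hc'
  have hL0 : 0 < L := by linarith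
  set D := p' - p with hD
  have hD0 : D ≠ 0 := sub_ne_zero.2 hpp
  have hDm : ‖D‖ ≤ 1/10 := (norm_sub_le _ _).trans (by linarith)
  have hDp : 0 < ‖D‖ := norm_pos_iff.2 hD0
  obtain ⟨xs, π, e, hxs, hπ, he, hvx, htouch⟩ := contact_geom (v := fun y => w y - bmp κ N y)
    (hw.sub (bmp_cont κ N)) (x := x) (p := p) (D := D) hr hL hLr hD0 (fun y hy => by
      apply hcon
      have := norm_add_le (y - x) x
      rw [sub_add_cancel] at this; linarith) (fun y hy => by
      have hy6 : ‖y‖ ≤ 6 := by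
        have := norm_add_le (y - x) x
        rw [sub_add_cancel] at this; linarith
      have h1 := hcon' y hy6
      have h2 := hcon x' (by linarith)
      have h3 : ⟪D, x' - x⟫ ≤ ‖D‖ * r :=
        (real_inner_le_norm _ _).trans (by gcongr)
      have h4 : ⟪p', y - x'⟫ + ⟪p, x' - x⟫ = ⟪p, y - x⟫ + ⟪D, y - x⟫ - ⟪D, x' - x⟫ := by
        simp only [hD, inner_sub_left, inner_sub_right]; ring
      linarith)
  refine ⟨xs, hxs, ?_⟩
  set m := ‖D‖ with hm
  set τ := m / r with hτ
  have hτ0 : 0 < τ := by positivity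
  have hmτ : m = τ * r := by rw [hτ]; field_simp
  have hxs1 : ‖xs - x‖ < 1/2 := by linarith
  have hxs5 : ‖xs‖ < 9/2 := by
    have := norm_add_le (xs - x) x
    rw [sub_add_cancel] at this; linarith
  set G := bmp κ N xs with hG
  have hG0 : 0 < G := bmp_pos hN xs
  have hGN : G ≤ N := bmp_le (by linarith) hN xs
  obtain ⟨s, hs0, hs1, hloc⟩ := bmp_local (d := d) hκ hN hη
  set ps : Ed d := p + π + (-(2 * κ * G)) • xs with hps
  have hpsn : ‖ps‖ ≤ 1 + 10 * κ * N := by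
    have h1 : ‖(-(2 * κ * G)) • xs‖ ≤ 2 * κ * N * 5 := by
      rw [norm_smul, norm_neg, Real.norm_eq_abs, abs_of_pos (by positivity)]
      gcongr; linarith
    have h2 : ‖ps‖ ≤ ‖p + π‖ + ‖(-(2 * κ * G)) • xs‖ := norm_add_le _ _
    have h3 : ‖p + π‖ ≤ ‖p‖ + ‖π‖ := norm_add_le _ _
    linarith
  have hpsi : ∀ z, ⟪ps, z⟫ = ⟪p + π, z⟫ - 2 * κ * G * ⟪xs, z⟫ := by
    intro z
    rw [hps, inner_add_left, inner_smul_left]; simp only [conj_trivial]; ring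
  have hκG : κ * G ≤ κ * N := by gcongr
  have hκG0 : 0 < κ * G := by positivity
  have hτL : τ / L ^ 2 ≤ τ := div_le_self hτ0.le (by nlinarith)
  have hτL0 : 0 < τ / L ^ 2 := by positivity
  have key := hJ xs (by linarith) ps e (Real.sqrt (4 * κ ^ 2 * G) • xs)
    (τ / L ^ 2 + 2 * κ * G + 2 * η) (min s (L * r)) (4 * τ + 2 * κ * N + 2 * N + 27)
    (lt_min hs0 (by positivity)) ((min_le_left _ _).trans hs1) (by positivity)
    (by nlinarith) (by nlinarith [mul_pos (by linarith : 0 < κ) hN]) ?_ ?_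
  · rw [norm_smul, mul_pow, Real.norm_eq_abs, sq_abs, Real.sq_sqrt (by positivity), he] at key
    have h1 : LD * (τ / L ^ 2) ≤ lam / (6 * L) * τ := by
      rw [mul_div_assoc', div_le_iff₀ (by positivity)]
      have h2 : lam / (6 * L) * τ * L ^ 2 = lam * L / 6 * τ := by field_simp
      rw [h2]
      apply mul_le_mul_of_nonneg_right _ hτ0.le
      linarith
    have h2 : lam * (τ / (3 * L)) = 2 * (lam / (6 * L) * τ) := by field_simp; norm_num
    have h3 : ε * (4 * τ + 2 * κ * N + 2 * N + 27 + ‖ps‖) ≤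
        ε * (4 * τ + 2 * κ * N + 2 * N + 27 + (1 + 10 * κ * N)) := by gcongr
    linear_combination key + h1 + h3 + h2
  · intro z hz
    have hz1 := hz.trans_le (min_le_left _ _)
    have hz2 := hz.trans_le (min_le_right _ _)
    have h1 := htouch z hz2
    have h2 := hloc xs z (by linarith) hz1
    rw [hpsi, inner_smul_left, mul_pow]
    simp only [conj_trivial]
    rw [Real.sq_sqrt (by positivity)]
    linear_combination h1 + h2
  · intro z
    have hzn := norm_nonneg z
    by_cases hz1 : ‖z‖ < 1
    · have hmem : z ∈ ball (0 : Ed d) 1 := by rwa [mem_ball_zero_iff]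
      rw [indicator_of_mem hmem, min_eq_left (by nlinarith), hpsi]
      have h2 := bmp_global (κ := κ) hN xs z
      by_cases hz2 : ‖z‖ < L * r
      · have h1 := htouch z hz2
        have h3 : 0 ≤ ⟪e, z⟫ ^ 2 := sq_nonneg _
        have h4 : (κ * G + τ / L ^ 2 / 2) * ‖z‖ ^ 2 ≤ (4 * τ + 2 * κ * N + 2 * N + 27) * ‖z‖ ^ 2 := by
          apply mul_le_mul_of_nonneg_right _ (sq_nonneg _)
          nlinarith
        linear_combination h1 + h2 + h4 + h3 / 2
      · push Not at hz2
        have h1 := hcon (xs + z) (by have := norm_add_le xs z; linarith)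
        have h3 : ⟪p, xs + z - x⟫ = ⟪p, xs - x⟫ + ⟪p, z⟫ := by
          rw [← inner_add_right]; congr 1; abel
        rw [h3] at h1
        have h4 : ⟪π, z⟫ ≤ 2 * m * ‖z‖ := (real_inner_le_norm _ _).trans (by gcongr)
        have h5 : m * r * L ≤ τ * ‖z‖ ^ 2 := by
          rw [hmτ]
          have h6 : r * L * (r * L) ≤ ‖z‖ * ‖z‖ := mul_self_le_mul_self (by positivity) (by linarith)
          have h7 : r * L * r ≤ r * L * (r * L) := by
            apply mul_le_mul_of_nonneg_left _ (by positivity); nlinarith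
          have h8 := mul_le_mul_of_nonneg_left (h7.trans h6) hτ0.le
          linarith
        have h6 : 2 * m * ‖z‖ ≤ 2 * τ * ‖z‖ ^ 2 := by
          rw [hmτ]
          have h7 : r ≤ ‖z‖ := by nlinarith
          have h8 := mul_le_mul_of_nonneg_left h7 (by positivity : 0 ≤ 2 * τ * ‖z‖)
          linarith
        have h7 : (κ * G + 3 * τ) * ‖z‖ ^ 2 ≤ (4 * τ + 2 * κ * N + 2 * N + 27) * ‖z‖ ^ 2 := by
          apply mul_le_mul_of_nonneg_right _ (sq_nonneg _)
          nlinarith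
        rw [inner_add_left]
        linear_combination h1 + h2 + h4 + h5 + h6 + h7 + hvx
    · push Not at hz1
      have hmem : z ∉ ball (0 : Ed d) 1 := by rw [mem_ball_zero_iff]; exact not_lt.2 hz1
      rw [indicator_of_notMem hmem, min_eq_right (by nlinarith)]
      have h1 := hw4 (xs + z)
      have h2 := norm_add_le xs z
      have h3 : ⟪p, xs - x⟫ ≤ 1 := by
        refine (real_inner_le_norm _ _).trans ?_
        have := mul_le_mul hp1 hxs1.le (norm_nonneg _) (by norm_num)
        linarith
      have h4 : m * r * L ≤ 1 := by nlinarith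
      have h5 := bmp_pos (κ := κ) hN x
      have h6 : w xs ≤ 2 + 2 * N := by linarith
      have h7 : 0 ≤ (4 * τ + 2 * κ * N) * ‖z‖ := by positivity
      have h8 : (2 * N + 23) * 1 ≤ (2 * N + 23) * ‖z‖ := mul_le_mul_of_nonneg_left hz1 (by positivity)
      nlinarith


lemma exists_contact {d : ℕ} {κ N : ℝ} (hκ : 1 ≤ κ) (hN : N = 3 / (Real.exp (-9 * κ) - Real.exp (-16 * κ)))
    {w : Ed d → ℝ} (hw : Continuous w) (hw0 : ∀ y, ‖y‖ ≤ 6 → 0 ≤ w y) {xh : Ed d} (hxh : ‖xh‖ ≤ 3)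
    (hwx : w xh ≤ 1) {p : Ed d} (hp : ‖p‖ ≤ 1/20) : ∃ x, Contact κ N w x p := by
  have hexp : Real.exp (-16 * κ) < Real.exp (-9 * κ) := Real.exp_lt_exp.2 (by linarith)
  have hN0 : 0 < N := by rw [hN]; exact div_pos (by norm_num) (by linarith)
  have hN3 : N * Real.exp (-9 * κ) = N * Real.exp (-16 * κ) + 3 := by
    have : N * (Real.exp (-9 * κ) - Real.exp (-16 * κ)) = 3 := by
      rw [hN]; exact div_mul_cancel₀ _ (by linarith)
    linarith
  set T := N * Real.exp (-16 * κ) with hT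
  have hTpos : 0 < T := by positivity
  have hout : ∀ y : Ed d, 4 ≤ ‖y‖ → bmp κ N y ≤ T := by
    intro y hy
    unfold bmp
    apply mul_le_mul_of_nonneg_left _ hN0.le
    apply Real.exp_le_exp.2
    have : 16 ≤ ‖y‖ ^ 2 := by nlinarith
    nlinarith
  have hin : T + 3 ≤ bmp κ N xh := by
    unfold bmp
    rw [← hN3]
    apply mul_le_mul_of_nonneg_left _ hN0.le
    apply Real.exp_le_exp.2
    have : ‖xh‖ ^ 2 ≤ 9 := by nlinarith [norm_nonneg xh]
    nlinarith
  have hcont : Continuous fun y => w y - bmp κ N y - ⟪p, y⟫ := by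
    have := bmp_cont (d := d) κ N
    fun_prop
  obtain ⟨x, hx, hmin⟩ := (isCompact_closedBall (0 : Ed d) 6).exists_isMinOn
    (nonempty_closedBall.2 (by norm_num)) hcont.continuousOn
  rw [mem_closedBall_zero_iff] at hx
  have hm : ∀ y : Ed d, ‖y‖ ≤ 6 → w x - bmp κ N x - ⟪p, x⟫ ≤ w y - bmp κ N y - ⟪p, y⟫ :=
    fun y hy => hmin (mem_closedBall_zero_iff.2 hy)
  have hip : ∀ y : Ed d, |⟪p, y⟫| ≤ 1/20 * ‖y‖ := fun y =>
    (abs_real_inner_le_norm p y).trans (by gcongr)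
  have h1 := hm xh (by linarith)
  have h2 := abs_le.1 (hip xh)
  have h3 := abs_le.1 (hip x)
  have hx4 : ‖x‖ < 4 := by
    by_contra hcon
    push Not at hcon
    have h4 := hout x hcon
    have h5 := hw0 x hx
    linarith
  refine ⟨x, hp, hx4, ?_, ?_⟩
  · have := bmp_le (by linarith) hN0 x (κ := κ)
    linarith
  · intro y hy
    have := hm y hy
    rw [inner_sub_right]; linarith

set_option maxHeartbeats 1000000 in
lemma contact_lip {d : ℕ} {lam LD : ℝ} (hlam : 0 < lam) (hLD : 0 ≤ LD) :
    ∃ κ N ε c C5 : ℝ, 1 ≤ κ ∧ N = 3 / (Real.exp (-9 * κ) - Real.exp (-16 * κ)) ∧ 0 < ε ∧ 0 < c ∧ 0 < C5 ∧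
      ∀ w g : Ed d → ℝ, Continuous w → (∀ y, -(4 * ‖y‖) ≤ w y) → JetSup lam LD ε g 5 w →
      ContinuousOn g (ball 0 5) → (∀ y, ‖y‖ < 5 → 0 ≤ g y) →
      ∀ x p, Contact κ N w x p → ∀ η > 0, ∃ ρ > 0, ∀ r, 0 < r → r ≤ ρ → ∀ x' p', Contact κ N w x' p' →
        ‖x' - x‖ ≤ r → c * ‖p' - p‖ ≤ r * (g x + η + if ‖x‖ < 1 then C5 else 0) := by
  set κ := 1 + (2 * LD + 1) / lam with hκd
  have hκ : 1 ≤ κ := by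
    have : 0 ≤ (2 * LD + 1) / lam := by positivity
    linarith
  have hκl : 2 * LD + 1 ≤ κ * lam := by
    rw [hκd, add_mul, div_mul_cancel₀ _ hlam.ne']; linarith
  set N := 3 / (Real.exp (-9 * κ) - Real.exp (-16 * κ)) with hNd
  have hexp : Real.exp (-16 * κ) < Real.exp (-9 * κ) := Real.exp_lt_exp.2 (by linarith)
  have hN0 : 0 < N := div_pos (by norm_num) (by linarith)
  set L := 2 + 6 * LD / lam with hLd
  have hL : 2 ≤ L := by
    have : 0 ≤ 6 * LD / lam := by positivity
    linarith
  have hLL : 6 * LD ≤ lam * L := by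
    rw [hLd, mul_add, mul_div_cancel₀ _ hlam.ne']; linarith
  set c3 := N * Real.exp (-25 * κ) * κ with hc3
  have hc30 : 0 < c3 := by positivity
  set ε := min (lam / (48 * L)) (c3 / 2 / (12 * κ * N + 2 * N + 28)) with hεd
  have hL0 : 0 < L := by linarith
  have hκ0 : 0 < κ := by linarith
  have hε : 0 < ε := lt_min (by positivity) (by positivity)
  have hε1 : lam / (12 * L) ≤ lam / (6 * L) - 4 * ε := by
    have h1 : ε ≤ lam / (48 * L) := min_le_left _ _
    have h2 : lam / (48 * L) = lam / (12 * L) / 4 := by field_simp; norm_num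
    have h3 : lam / (6 * L) = 2 * (lam / (12 * L)) := by field_simp; norm_num
    linarith
  have hε2 : ε * (12 * κ * N + 2 * N + 28) ≤ c3 / 2 := by
    rw [← le_div_iff₀ (by positivity)]
    exact min_le_right _ _
  refine ⟨κ, N, ε, lam / (12 * L), 2 * κ * LD * N + c3, hκ, rfl, hε, by positivity, by positivity, ?_⟩
  intro w g hw hw4 hJ hg hg0 x p hc η hη
  have hx4 : ‖x‖ < 4 := hc.2.1
  have hgx : ContinuousAt g x := hg.continuousAt (isOpen_ball.mem_nhds (by rw [mem_ball_zero_iff]; linarith))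
  obtain ⟨δ, hδ, hgδ⟩ := Metric.continuousAt_iff.1 hgx η hη
  set η' := min 1 (c3 / 4 / (LD + 1)) with hη'
  have hη'0 : 0 < η' := lt_min one_pos (by positivity)
  have hη'2 : 2 * η' * LD ≤ c3 / 2 := by
    have h1 : η' ≤ c3 / 4 / (LD + 1) := min_le_right _ _
    rw [le_div_iff₀ (by positivity)] at h1
    nlinarith
  refine ⟨min (1 / (2 * L)) (δ / L), lt_min (by positivity) (by positivity), ?_⟩
  intro r hr hrρ x' p' hc' hxx
  have hr1 : r ≤ 1 / (2 * L) := hrρ.trans (min_le_left _ _)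
  have hr2 : r ≤ δ / L := hrρ.trans (min_le_right _ _)
  rw [le_div_iff₀ (by positivity)] at hr1 hr2
  have hgx0 : 0 ≤ g x := hg0 x (by linarith)
  have hC5 : 0 < 2 * κ * LD * N + c3 := by positivity
  have hite : (0:ℝ) ≤ if ‖x‖ < 1 then 2 * κ * LD * N + c3 else 0 := by
    split_ifs <;> linarith
  by_cases hpp : p' = p
  · rw [hpp, sub_self, norm_zero, mul_zero]
    exact mul_nonneg hr.le (by linarith)
  obtain ⟨xs, hxs, hineq⟩ := contact_core hlam hLD hκ hN0 hL hLL hε.le hw hw4 hJ hc hc' hpp hr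
    (by linarith) hxx hη'0 (min_le_left _ _)
  have hgxs : g xs ≤ g x + η := by
    have := hgδ (x := xs) (by rw [dist_eq_norm]; linarith)
    rw [Real.dist_eq] at this
    linarith [(abs_lt.1 this).2]
  have hxs1 : ‖xs - x‖ < 1/2 := by linarith
  have hxsn : ‖xs‖ ≤ 5 := by
    have := norm_add_le (xs - x) x
    rw [sub_add_cancel] at this; linarith
  set τ := ‖p' - p‖ / r with hτ
  have hτ0 : 0 ≤ τ := by positivity
  have hτe : lam / (12 * L) * ‖p' - p‖ = r * (lam / (12 * L) * τ) := by rw [hτ]; field_simp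
  have hτ1 := mul_le_mul_of_nonneg_right hε1 hτ0
  rw [hτe]
  apply mul_le_mul_of_nonneg_left _ hr.le
  have hG0 : 0 < bmp κ N xs := bmp_pos hN0 xs
  have hGN : bmp κ N xs ≤ N := bmp_le hκ0.le hN0 xs
  by_cases hx1 : ‖x‖ < 1
  · rw [if_pos hx1]
    have h1 : -(2 * κ * LD * N) ≤ bmp κ N xs * (4 * κ ^ 2 * lam * ‖xs‖ ^ 2 - 2 * κ * LD) := by
      have h2 : 0 ≤ bmp κ N xs * (4 * κ ^ 2 * lam * ‖xs‖ ^ 2) := by positivity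
      have h3 : 2 * κ * LD * bmp κ N xs ≤ 2 * κ * LD * N := mul_le_mul_of_nonneg_left hGN (by positivity)
      linarith
    linarith
  · rw [if_neg hx1]
    push Not at hx1
    have h2 : 1/2 ≤ ‖xs‖ := by
      have := norm_sub_norm_le x xs
      rw [norm_sub_rev] at this; linarith
    have h3 : N * Real.exp (-25 * κ) ≤ bmp κ N xs := by
      unfold bmp
      apply mul_le_mul_of_nonneg_left _ hN0.le
      apply Real.exp_le_exp.2
      have : ‖xs‖ ^ 2 ≤ 25 := by nlinarith
      nlinarith
    have h4 : κ ≤ 4 * κ ^ 2 * lam * ‖xs‖ ^ 2 - 2 * κ * LD := by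
      have h5 : 1/4 ≤ ‖xs‖ ^ 2 := by nlinarith
      have h6 : 4 * κ ^ 2 * lam * (1/4) ≤ 4 * κ ^ 2 * lam * ‖xs‖ ^ 2 :=
        mul_le_mul_of_nonneg_left h5 (by positivity)
      have h7 := mul_le_mul_of_nonneg_left hκl hκ0.le
      nlinarith
    have h5 : c3 ≤ bmp κ N xs * (4 * κ ^ 2 * lam * ‖xs‖ ^ 2 - 2 * κ * LD) := by
      rw [hc3]
      exact mul_le_mul h3 h4 hκ0.le hG0.le
    linarith

lemma covering_measure_avg {d : ℕ} {B S : Set (Ed d)} {X : Ed d → Ed d} {rad Φ : Ed d → ℝ} {h : Ed d → ℝ≥0∞} {c : ℝ}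
    (hc : 0 < c) (hrad : ∀ p ∈ B, 0 < rad p ∧ rad p ≤ 1) (hΦ : ∀ p ∈ B, 0 ≤ Φ p)
    (hlip : ∀ p ∈ B, ∀ p' ∈ B, dist (X p') (X p) ≤ 5 * rad p → c * ‖p' - p‖ ≤ 5 * rad p * Φ p)
    (hS : ∀ p ∈ B, closedBall (X p) (rad p) ⊆ S)
    (hh : ∀ p ∈ B, ENNReal.ofReal (Φ p ^ d) * volume (closedBall (X p) (rad p))
      ≤ ∫⁻ y in closedBall (X p) (rad p), h y) :
    volume B ≤ ENNReal.ofReal ((5 / c) ^ d) * ∫⁻ y in S, h y := by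
  obtain ⟨u, hut, hdisj, hcov⟩ := Vitali.exists_disjoint_subfamily_covering_enlargement_closedBall
    B X rad 1 (fun p hp => (hrad p hp).2) 5 (by norm_num)
  have hcount : u.Countable := by
    apply hdisj.countable_of_nonempty_interior
    intro p hp
    exact ⟨X p, by
      rw [mem_interior]
      exact ⟨ball (X p) (rad p), ball_subset_closedBall, isOpen_ball, mem_ball_self (hrad p (hut hp)).1⟩⟩
  have hBsub : B ⊆ ⋃ p ∈ u, closedBall p ((5 * Φ p / c) * rad p) := by
    intro a ha
    obtain ⟨b, hb, hab⟩ := hcov a ha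
    refine mem_iUnion₂.2 ⟨b, hb, ?_⟩
    have h1 : X a ∈ closedBall (X b) (5 * rad b) := hab (mem_closedBall_self (hrad a ha).1.le)
    have h2 := hlip b (hut hb) a ha h1
    rw [mem_closedBall, dist_eq_norm]
    have h3 : 5 * Φ b / c * rad b = (5 * rad b * Φ b) / c := by ring
    rw [h3, le_div_iff₀ hc]; linarith
  have hvol : ∀ p ∈ u, volume (closedBall p ((5 * Φ p / c) * rad p)) ≤
      ENNReal.ofReal ((5 / c) ^ d) * ∫⁻ y in closedBall (X p) (rad p), h y := by
    intro p hp
    have hpB := hut hp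
    rw [Measure.addHaar_closedBall_mul volume p (by have := hΦ p hpB; positivity) (hrad p hpB).1.le]
    rw [finrank_euclideanSpace_fin]
    have h1 : (5 * Φ p / c) ^ d = (5 / c) ^ d * Φ p ^ d := by
      rw [← mul_pow]; congr 1; ring
    rw [h1, ENNReal.ofReal_mul (by positivity), mul_assoc]
    gcongr
    have h2 := hh p hpB
    refine le_trans (le_of_eq ?_) h2
    congr 1
    exact (Measure.addHaar_closedBall_center volume (X p) (rad p)).symm
  have := hcount.to_subtype
  calc volume B ≤ volume (⋃ p ∈ u, closedBall p ((5 * Φ p / c) * rad p)) := measure_mono hBsub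
    _ ≤ ∑' p : u, volume (closedBall (p : Ed d) ((5 * Φ p / c) * rad p)) :=
        measure_biUnion_le _ hcount _
    _ ≤ ∑' p : u, ENNReal.ofReal ((5 / c) ^ d) * ∫⁻ y in closedBall (X p) (rad p), h y :=
        ENNReal.tsum_le_tsum fun p => hvol p p.2
    _ = ENNReal.ofReal ((5 / c) ^ d) * ∑' p : u, ∫⁻ y in closedBall (X p) (rad p), h y := ENNReal.tsum_mul_left
    _ = ENNReal.ofReal ((5 / c) ^ d) * ∫⁻ y in ⋃ p : u, closedBall (X p) (rad p), h y := by
        rw [lintegral_iUnion (fun p => measurableSet_closedBall)]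
        exact fun p q hpq => hdisj p.2 q.2 (fun h => hpq (Subtype.ext h))
    _ ≤ _ := by
        gcongr
        exact iUnion_subset fun p => hS p (hut p.2)

lemma covering_measure {d : ℕ} {B S : Set (Ed d)} {X : Ed d → Ed d} {rad Φ : Ed d → ℝ} {h : Ed d → ℝ≥0∞} {c : ℝ}
    (hc : 0 < c) (hrad : ∀ p ∈ B, 0 < rad p ∧ rad p ≤ 1) (hΦ : ∀ p ∈ B, 0 ≤ Φ p)
    (hlip : ∀ p ∈ B, ∀ p' ∈ B, dist (X p') (X p) ≤ 5 * rad p → c * ‖p' - p‖ ≤ 5 * rad p * Φ p)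
    (hS : ∀ p ∈ B, closedBall (X p) (rad p) ⊆ S)
    (hh : ∀ p ∈ B, ∀ y ∈ closedBall (X p) (rad p), ENNReal.ofReal (Φ p ^ d) ≤ h y) :
    volume B ≤ ENNReal.ofReal ((5 / c) ^ d) * ∫⁻ y in S, h y := by
  refine covering_measure_avg hc hrad hΦ hlip hS fun p hp => ?_
  rw [← setLIntegral_const]
  exact setLIntegral_mono' measurableSet_closedBall (hh p hp)


lemma add3_pow_le {d : ℕ} {a b c : ℝ} (ha : 0 ≤ a) (hb : 0 ≤ b) (hc : 0 ≤ c) :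
    (a + b + c) ^ d ≤ 3 ^ d * (a ^ d + b ^ d + c ^ d) := by
  have h1 : ∀ t : ℝ, 0 ≤ t → a ≤ t → b ≤ t → c ≤ t → (a + b + c) ^ d ≤ 3 ^ d * t ^ d := by
    intro t ht h1 h2 h3
    rw [← mul_pow]
    exact pow_le_pow_left₀ (by positivity) (by linarith) d
  have ha' := pow_nonneg ha d
  have hb' := pow_nonneg hb d
  have hc' := pow_nonneg hc d
  rcases le_total a b with h | h
  · rcases le_total b c with h' | h'
    · refine (h1 c hc (by linarith) h' le_rfl).trans ?_
      gcongr; linarith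
    · refine (h1 b hb h le_rfl h').trans ?_
      gcongr; linarith
  · rcases le_total a c with h' | h'
    · refine (h1 c hc h' (by linarith) le_rfl).trans ?_
      gcongr; linarith
    · refine (h1 a ha le_rfl h h').trans ?_
      gcongr; linarith

set_option maxHeartbeats 1000000 in
lemma point_measure {d : ℕ} (hd : 1 ≤ d) {lam LD : ℝ} (hlam : 0 < lam) (hLD : 0 ≤ LD) :
    ∃ ε δ μ M : ℝ, 0 < ε ∧ 0 < δ ∧ 0 < μ ∧ 1 < M ∧
      ∀ w g : Ed d → ℝ, Continuous w → (∀ y, ‖y‖ ≤ 6 → 0 ≤ w y) → (∀ y, -(4 * ‖y‖) ≤ w y) →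
      JetSup lam LD ε g 5 w → ContinuousOn g (ball 0 5) → (∀ y, ‖y‖ < 5 → 0 ≤ g y) →
      ∫⁻ y in ball (0 : Ed d) 5, ENNReal.ofReal (g y ^ d) ≤ ENNReal.ofReal δ →
      ∀ xh : Ed d, ‖xh‖ ≤ 3 → w xh ≤ 1 → ENNReal.ofReal μ ≤ volume ({y | w y < M} ∩ ball (0 : Ed d) 1) := by
  obtain ⟨κ, N, ε, c, C5, hκ, hN, hε, hc, hC5, hmain⟩ := contact_lip (d := d) hlam hLD
  set V : ℝ := (volume (ball (0 : Ed d) (1/20))).toReal with hV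
  set V5 : ℝ := (volume (ball (0 : Ed d) 5)).toReal with hV5
  have hVe : volume (ball (0 : Ed d) (1/20)) = ENNReal.ofReal V :=
    (ENNReal.ofReal_toReal measure_ball_lt_top.ne).symm
  have hV5e : volume (ball (0 : Ed d) 5) = ENNReal.ofReal V5 :=
    (ENNReal.ofReal_toReal measure_ball_lt_top.ne).symm
  have hV0 : 0 < V := ENNReal.toReal_pos (measure_ball_pos _ _ (by norm_num)).ne' measure_ball_lt_top.ne
  have hV50 : 0 < V5 := ENNReal.toReal_pos (measure_ball_pos _ _ (by norm_num)).ne' measure_ball_lt_top.ne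
  set K3 : ℝ := (5 / c) ^ d * 3 ^ d with hK3
  have hK30 : 0 < K3 := by positivity
  set δ := V / (3 * K3) with hδ
  set η := min (1/2) (V / (6 * K3 * V5)) with hη
  have hη0 : 0 < η := lt_min (by norm_num) (by positivity)
  have hη1 : η ≤ 1/2 := min_le_left _ _
  have hη2 : K3 * ((2 * η) ^ d * V5) ≤ V / 3 := by
    have h1 : (2 * η) ^ d ≤ 2 * η := pow_le_of_le_one (by linarith) (by linarith) (by omega)
    have h2 : η ≤ V / (6 * K3 * V5) := min_le_right _ _
    rw [le_div_iff₀ (by positivity)] at h2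
    have h3 : K3 * ((2 * η) ^ d * V5) ≤ K3 * ((2 * η) * V5) := by gcongr
    linarith
  refine ⟨ε, δ, V / (3 * K3 * C5 ^ d), N + 2, hε, by positivity, by positivity, ?_, ?_⟩
  · have hexp : Real.exp (-16 * κ) < Real.exp (-9 * κ) := Real.exp_lt_exp.2 (by linarith)
    have : 0 < N := by rw [hN]; exact div_pos (by norm_num) (by linarith)
    linarith
  intro w g hw hw0 hw4 hJ hg hg0 hgint xh hxh hwx
  set U : Set (Ed d) := {y | w y < N + 2} ∩ ball (0 : Ed d) 1 with hU
  have hUo : IsOpen U := (isOpen_lt hw continuous_const).inter isOpen_ball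
  have hUfin : volume U ≠ ⊤ := ((measure_mono inter_subset_right).trans_lt measure_ball_lt_top).ne
  have hUe : volume U = ENNReal.ofReal (volume U).toReal := (ENNReal.ofReal_toReal hUfin).symm
  have hex : ∀ p : Ed d, ∃ x : Ed d, ∃ r : ℝ, p ∈ ball (0 : Ed d) (1/20) → Contact κ N w x p ∧ 0 < r ∧ r ≤ 1 ∧
      (∀ x' p', Contact κ N w x' p' → ‖x' - x‖ ≤ 5 * r →
        c * ‖p' - p‖ ≤ 5 * r * (g x + η + if ‖x‖ < 1 then C5 else 0)) ∧
      ∀ y ∈ closedBall x r, g x ≤ g y + η ∧ (‖x‖ < 1 → y ∈ U) := by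
    intro p
    by_cases hp : p ∈ ball (0 : Ed d) (1/20)
    swap
    · exact ⟨0, 0, fun h => absurd h hp⟩
    rw [mem_ball_zero_iff] at hp
    obtain ⟨x, hx⟩ := exists_contact hκ hN hw hw0 hxh hwx hp.le
    obtain ⟨ρ, hρ, hlip⟩ := hmain w g hw hw4 hJ hg hg0 x p hx η hη0
    have hx4 := hx.2.1
    have hgx : ContinuousAt g x := hg.continuousAt (isOpen_ball.mem_nhds (by rw [mem_ball_zero_iff]; linarith))
    have hW : {y | g x ≤ g y + η ∧ (‖x‖ < 1 → y ∈ U)} ∈ nhds x := by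
      have h1 : ∀ᶠ y in nhds x, g x - η < g y := hgx.eventually_const_lt (by linarith)
      have h2 : ∀ᶠ y in nhds x, (‖x‖ < 1 → y ∈ U) := by
        by_cases h : ‖x‖ < 1
        · have : U ∈ nhds x := hUo.mem_nhds ⟨by have := hx.2.2.1; exact (by linarith : w x < N + 2),
            mem_ball_zero_iff.2 h⟩
          filter_upwards [this] with y hy _ using hy
        · exact Filter.Eventually.of_forall fun y h' => absurd h' h
      filter_upwards [h1, h2] with y hy1 hy2
      exact ⟨by linarith, hy2⟩
    obtain ⟨δ', hδ', hsub⟩ := Metric.nhds_basis_closedBall.mem_iff.1 hW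
    refine ⟨x, min (ρ / 5) (min 1 δ'), fun _ => ⟨hx, lt_min (by positivity) (lt_min one_pos hδ'),
      (min_le_right _ _).trans (min_le_left _ _), ?_, ?_⟩⟩
    · intro x' p' hc' hxx
      have hr0 : 0 < min (ρ / 5) (min 1 δ') := lt_min (by positivity) (lt_min one_pos hδ')
      have hr1 : min (ρ / 5) (min 1 δ') ≤ ρ / 5 := min_le_left _ _
      exact hlip _ (by linarith) (by linarith) x' p' hc' hxx
    · intro y hy
      exact hsub (closedBall_subset_closedBall ((min_le_right _ _).trans (min_le_right _ _)) hy)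
  choose X rad hXr using hex
  set I : Ed d → ℝ := fun y => U.indicator (fun _ => C5) y with hI
  have hI0 : ∀ y, 0 ≤ I y := fun y => indicator_nonneg (fun _ _ => hC5.le) y
  have hite : ∀ x : Ed d, (0:ℝ) ≤ if ‖x‖ < 1 then C5 else 0 := by
    intro x; split_ifs <;> linarith
  have hcm := covering_measure (B := ball (0 : Ed d) (1/20)) (S := ball (0 : Ed d) 5) (X := X) (rad := rad)
    (Φ := fun p => g (X p) + η + if ‖X p‖ < 1 then C5 else 0)
    (h := fun y => ENNReal.ofReal ((g y + 2 * η + I y) ^ d)) hc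
    (fun p hp => ⟨(hXr p hp).2.1, (hXr p hp).2.2.1⟩)
    (fun p hp => by
      have h1 := hg0 (X p) (by linarith [(hXr p hp).1.2.1])
      have h2 := hite (X p)
      linarith)
    (fun p hp p' hp' hdist => (hXr p hp).2.2.2.1 _ _ (hXr p' hp').1 (by rwa [← dist_eq_norm]))
    (fun p hp y hy => by
      rw [mem_ball_zero_iff]
      rw [mem_closedBall, dist_eq_norm] at hy
      have h1 := norm_add_le (y - X p) (X p)
      rw [sub_add_cancel] at h1
      linarith [(hXr p hp).1.2.1, (hXr p hp).2.2.1])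
    (fun p hp y hy => by
      apply ENNReal.ofReal_le_ofReal
      have h1 := hg0 (X p) (by linarith [(hXr p hp).1.2.1])
      have h2 := hite (X p)
      apply pow_le_pow_left₀ (by linarith)
      obtain ⟨h3, h4⟩ := (hXr p hp).2.2.2.2 y hy
      have h5 : (if ‖X p‖ < 1 then C5 else 0) ≤ I y := by
        split_ifs with h
        · simp only [hI]; rw [indicator_of_mem (h4 h)]
        · exact hI0 y
      linarith)
  have hintg : ∫⁻ y in ball (0 : Ed d) 5, ENNReal.ofReal ((g y + 2 * η + I y) ^ d) ≤
      ENNReal.ofReal (3 ^ d * (δ + (2 * η) ^ d * V5 + C5 ^ d * (volume U).toReal)) := by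
    have h1 : ∀ y ∈ ball (0 : Ed d) 5, ENNReal.ofReal ((g y + 2 * η + I y) ^ d) ≤
        ENNReal.ofReal (3 ^ d) * (ENNReal.ofReal (g y ^ d) + (ENNReal.ofReal ((2 * η) ^ d) +
          U.indicator (fun _ => ENNReal.ofReal (C5 ^ d)) y)) := by
      intro y hy
      have hgy := hg0 y (mem_ball_zero_iff.1 hy)
      have h2 := add3_pow_le (d := d) hgy (by linarith : 0 ≤ 2 * η) (hI0 y)
      refine (ENNReal.ofReal_le_ofReal h2).trans (le_of_eq ?_)
      have h3 : U.indicator (fun _ => ENNReal.ofReal (C5 ^ d)) y = ENNReal.ofReal (I y ^ d) := by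
        by_cases hy : y ∈ U
        · simp [hI, hy]
        · simp only [hI, indicator_of_notMem hy]
          rw [zero_pow (by omega), ENNReal.ofReal_zero]
      have := hI0 y
      rw [h3, ENNReal.ofReal_mul (by positivity), ENNReal.ofReal_add (by positivity) (by positivity),
        ENNReal.ofReal_add (by positivity) (by positivity), add_assoc]
    refine (setLIntegral_mono' measurableSet_ball h1).trans ?_
    have hmeas : Measurable (fun y => ENNReal.ofReal ((2 * η) ^ d) +
          U.indicator (fun _ => ENNReal.ofReal (C5 ^ d)) y) :=
      measurable_const.add ((measurable_const (a := ENNReal.ofReal (C5 ^ d))).indicator hUo.measurableSet)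
    rw [lintegral_const_mul' _ _ ENNReal.ofReal_ne_top, lintegral_add_right _ hmeas,
      lintegral_add_left measurable_const, setLIntegral_const, lintegral_indicator_const hUo.measurableSet,
      ENNReal.ofReal_mul (by positivity), ENNReal.ofReal_add (by positivity) (by positivity),
      ENNReal.ofReal_add (by positivity) (by positivity), ENNReal.ofReal_mul (by positivity),
      ENNReal.ofReal_mul (by positivity), ← hV5e, ← hUe, add_assoc]
    gcongr
    exact Measure.restrict_le_self
  have hfin := hcm.trans (mul_le_mul_right hintg (ENNReal.ofReal ((5 / c) ^ d)))
  rw [hVe, ← ENNReal.ofReal_mul (by positivity), ENNReal.ofReal_le_ofReal_iff (by positivity)] at hfin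
  rw [hUe]
  apply ENNReal.ofReal_le_ofReal
  rw [div_le_iff₀ (by positivity)]
  have h5 : K3 * δ = V / 3 := by rw [hδ]; field_simp
  have h6 : V ≤ K3 * δ + K3 * ((2 * η) ^ d * V5) + K3 * (C5 ^ d * (volume U).toReal) := by
    refine hfin.trans (le_of_eq ?_)
    rw [hK3]; ring
  nlinarith


set_option maxHeartbeats 1000000 in
lemma level_decay {d : ℕ} {μ M : ℝ} (hμ : 0 < μ) (hM : 1 < M) {w : Ed d → ℝ} (hw : Continuous w)
    (hPM : ∀ x : Ed d, ‖x‖ < 1/2 → ∀ r : ℝ, 0 < r → r ≤ 1 → ∀ k : ℕ, (∃ xh, ‖xh - x‖ ≤ 3 * r ∧ w xh ≤ M ^ k) →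
      ENNReal.ofReal (μ * r ^ d) ≤ volume ({y | w y < M ^ (k+1)} ∩ ball x r))
    {x0 : Ed d} (hx0 : ‖x0‖ < 1/2) (hwx0 : w x0 ≤ 1) (k : ℕ) :
    volume ({y | M ^ (k+1) < w y} ∩ ball (0 : Ed d) (1/2)) ≤
      ENNReal.ofReal (5 ^ d * ((volume (closedBall (0 : Ed d) 1)).toReal / μ)) *
        volume (({y | M ^ k < w y} \ {y | M ^ (k+1) < w y}) ∩ ball (0 : Ed d) 2) := by
  set E : ℕ → Set (Ed d) := fun k => {y | M ^ k < w y} with hE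
  have hEo : ∀ k, IsOpen (E k) := fun k => isOpen_lt continuous_const hw
  set v1 := (volume (closedBall (0 : Ed d) 1)).toReal with hv1
  have hv1e : volume (closedBall (0 : Ed d) 1) = ENNReal.ofReal v1 :=
    (ENNReal.ofReal_toReal measure_closedBall_lt_top.ne).symm
  have hv10 : 0 ≤ v1 := ENNReal.toReal_nonneg
  have hex : ∀ x : Ed d, ∃ r : ℝ, x ∈ E (k+1) ∩ ball (0 : Ed d) (1/2) → 0 < r ∧ 3 * r < 1 ∧
      closedBall x (2 * r) ⊆ E k ∧
      ENNReal.ofReal (μ * (2 * r) ^ d) ≤ volume (closedBall x (2 * r) \ E (k+1)) := by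
    intro x
    by_cases hx : x ∈ E (k+1) ∩ ball (0 : Ed d) (1/2)
    swap
    · exact ⟨0, fun h => absurd h hx⟩
    obtain ⟨hxE, hxb⟩ := hx
    rw [mem_ball_zero_iff] at hxb
    -- property of good radii
    have hgood : ∀ r, 0 < r → r ≤ 1 → volume (ball x r \ E (k+1)) < ENNReal.ofReal (μ * r ^ d) →
        closedBall x (3 * r) ⊆ E k := by
      intro r hr hr1 hlt y hy
      by_contra hyE
      have hyw : w y ≤ M ^ k := not_lt.1 hyE
      rw [mem_closedBall, dist_eq_norm] at hy
      have h1 := hPM x hxb r hr hr1 k ⟨y, hy, hyw⟩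
      have h2 : volume ({y | w y < M ^ (k+1)} ∩ ball x r) ≤ volume (ball x r \ E (k+1)) := by
        apply measure_mono
        rintro z ⟨hz1, hz2⟩
        have hz1' : w z < M^(k+1) := hz1
        exact ⟨hz2, fun h => absurd (show M^(k+1) < w z from h) (not_lt.2 hz1'.le)⟩
      exact absurd (h1.trans h2) (not_le.2 hlt)
    have hsmall : ∀ r, 0 < r → r ≤ 1 → volume (ball x r \ E (k+1)) < ENNReal.ofReal (μ * r ^ d) → 3 * r < 1 := by
      intro r hr hr1 hlt
      by_contra hcon
      have h1 : x0 ∈ closedBall x (3 * r) := by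
        rw [mem_closedBall, dist_eq_norm]
        have := norm_sub_le x0 x
        linarith
      have h2 : M ^ k < w x0 := hgood r hr hr1 hlt h1
      have h3 : 1 ≤ M ^ k := one_le_pow₀ hM.le
      linarith
    obtain ⟨r0, hr0, hsub⟩ := Metric.isOpen_iff.1 (hEo (k+1)) x hxE
    set r1 := min r0 (1/4) with hr1
    have hr10 : 0 < r1 := lt_min hr0 (by norm_num)
    have hr1S : volume (ball x r1 \ E (k+1)) < ENNReal.ofReal (μ * r1 ^ d) := by
      have : ball x r1 \ E (k+1) = ∅ := by
        rw [diff_eq_empty]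
        exact (ball_subset_ball (min_le_left _ _)).trans hsub
      rw [this, measure_empty]
      exact ENNReal.ofReal_pos.2 (by positivity)
    have hr14 : r1 ≤ 1/4 := min_le_right _ _
    by_contra hno
    have hall : ∀ n : ℕ, 2 ^ n * r1 ≤ 1 ∧ volume (ball x (2 ^ n * r1) \ E (k+1)) < ENNReal.ofReal (μ * (2 ^ n * r1) ^ d) := by
      intro n
      induction n with
      | zero => rw [pow_zero, one_mul]; exact ⟨by linarith, hr1S⟩
      | succ n ih =>
        obtain ⟨ih1, ih2⟩ := ih
        have hpos : 0 < 2 ^ n * r1 := by positivity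
        have hs := hsmall _ hpos ih1 ih2
        have hg := hgood _ hpos ih1 ih2
        rw [show (2:ℝ) ^ (n+1) * r1 = 2 * (2 ^ n * r1) by ring]
        refine ⟨by linarith, ?_⟩
        by_contra hcon
        apply hno
        refine ⟨2 ^ n * r1, fun _ => ⟨hpos, hs, (closedBall_subset_closedBall (by linarith)).trans hg, ?_⟩⟩
        refine (not_lt.1 hcon).trans (measure_mono ?_)
        exact diff_subset_diff_left ball_subset_closedBall
    obtain ⟨n, hn⟩ := pow_unbounded_of_one_lt (1 / r1) (by norm_num : (1:ℝ) < 2)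
    rw [div_lt_iff₀ hr10] at hn
    linarith [(hall n).1]
  choose r hr using hex
  have key := covering_measure_avg (B := E (k+1) ∩ ball (0 : Ed d) (1/2)) (S := ball (0 : Ed d) 2) (X := id)
    (rad := fun x => 2 * r x) (Φ := fun _ => 1) (c := 1)
    (h := fun y => (E k \ E (k+1)).indicator (fun _ => ENNReal.ofReal (v1 / μ)) y) one_pos
    (fun x hx => ⟨by linarith [(hr x hx).1], by linarith [(hr x hx).2.1]⟩)
    (fun _ _ => zero_le_one)
    (fun p hp p' hp' h => by
      rw [dist_eq_norm] at h
      simpa using h)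
    (fun x hx y hy => by
      rw [mem_ball_zero_iff]
      simp only [id, mem_closedBall, dist_eq_norm] at hy
      have h1 := norm_add_le (y - x) x
      rw [sub_add_cancel] at h1
      have h2 := mem_ball_zero_iff.1 hx.2
      linarith [(hr x hx).2.1])
    (fun x hx => by
      obtain ⟨h0, h1, h2, h3⟩ := hr x hx
      rw [lintegral_indicator_const ((hEo k).measurableSet.diff (hEo (k+1)).measurableSet),
        Measure.restrict_apply ((hEo k).measurableSet.diff (hEo (k+1)).measurableSet), one_pow,
        ENNReal.ofReal_one, one_mul]
      have h4 : closedBall x (2 * r x) \ E (k+1) ⊆ (E k \ E (k+1)) ∩ closedBall x (2 * r x) :=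
        fun y hy => ⟨⟨h2 hy.1, hy.2⟩, hy.1⟩
      have h5 := h3.trans (measure_mono h4)
      simp only [id]
      have h6 : volume (closedBall x (2 * r x)) = ENNReal.ofReal (v1 / μ) * ENNReal.ofReal (μ * (2 * r x) ^ d) := by
        have := Measure.addHaar_closedBall_mul volume x (by linarith : 0 ≤ 2 * r x) zero_le_one
        rw [mul_one, finrank_euclideanSpace_fin, hv1e] at this
        rw [this, ← ENNReal.ofReal_mul (by positivity), ← ENNReal.ofReal_mul (by positivity)]
        congr 1
        field_simp
      rw [h6]
      gcongr)
  refine key.trans (le_of_eq ?_)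
  rw [lintegral_indicator_const ((hEo k).measurableSet.diff (hEo (k+1)).measurableSet),
    Measure.restrict_apply ((hEo k).measurableSet.diff (hEo (k+1)).measurableSet), ← mul_assoc,
    ← ENNReal.ofReal_mul (by positivity), div_one]

lemma measure_decay {d : ℕ} {μ M : ℝ} (hμ : 0 < μ) (hM : 1 < M) :
    ∃ n : ℕ, ∀ w : Ed d → ℝ, Continuous w →
    (∀ x : Ed d, ‖x‖ < 1/2 → ∀ r : ℝ, 0 < r → r ≤ 1 → ∀ k : ℕ, (∃ xh, ‖xh - x‖ ≤ 3 * r ∧ w xh ≤ M ^ k) →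
      ENNReal.ofReal (μ * r ^ d) ≤ volume ({y | w y < M ^ (k+1)} ∩ ball x r)) →
    ∀ x0 : Ed d, ‖x0‖ < 1/2 → w x0 ≤ 1 →
      2 * volume ({y | M ^ n < w y} ∩ ball (0 : Ed d) (1/2)) < volume (ball (0 : Ed d) (1/2)) := by
  set C := ENNReal.ofReal (5 ^ d * ((volume (closedBall (0 : Ed d) 1)).toReal / μ)) with hC
  have hV : volume (ball (0 : Ed d) (1/2)) ≠ 0 := (measure_ball_pos _ _ (by norm_num)).ne'
  have hVt : volume (ball (0 : Ed d) (1/2)) ≠ ⊤ := measure_ball_lt_top.ne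
  have hT : 2 * (C * volume (ball (0 : Ed d) 2)) / volume (ball (0 : Ed d) (1/2)) ≠ ⊤ :=
    ENNReal.div_ne_top (ENNReal.mul_ne_top (by norm_num) (ENNReal.mul_ne_top ENNReal.ofReal_ne_top measure_ball_lt_top.ne)) hV
  obtain ⟨n, hn⟩ := ENNReal.exists_nat_gt hT
  refine ⟨n, fun w hw hPM x0 hx0 hwx0 => ?_⟩
  set E : ℕ → Set (Ed d) := fun k => {y | M ^ k < w y} with hE
  have hEo : ∀ k, IsOpen (E k) := fun k => isOpen_lt continuous_const hw
  have hmono : ∀ j k, j ≤ k → E k ⊆ E j := fun j k hjk y hy =>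
    lt_of_le_of_lt (pow_le_pow_right₀ hM.le hjk) hy
  have htel : ∀ k : ℕ, (∑ j ∈ Finset.range k, volume ((E j \ E (j+1)) ∩ ball (0 : Ed d) 2))
      + volume (E k ∩ ball (0 : Ed d) 2) ≤ volume (ball (0 : Ed d) 2) := by
    intro k
    induction k with
    | zero => simpa using measure_mono inter_subset_right
    | succ k ih =>
      refine le_trans (le_of_eq ?_) ih
      rw [Finset.sum_range_succ, add_assoc]
      congr 1
      rw [← measure_union _ ((hEo (k+1)).measurableSet.inter measurableSet_ball)]
      · congr 1
        rw [← union_inter_distrib_right, diff_union_of_subset (hmono k (k+1) (by omega))]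
      · exact (disjoint_sdiff_left.mono inter_subset_left inter_subset_left)
  have hsum : (n : ℝ≥0∞) * volume (E n ∩ ball (0 : Ed d) (1/2)) ≤ C * volume (ball (0 : Ed d) 2) := by
    calc (n : ℝ≥0∞) * volume (E n ∩ ball (0 : Ed d) (1/2))
        = ∑ j ∈ Finset.range n, volume (E n ∩ ball (0 : Ed d) (1/2)) := by simp
      _ ≤ ∑ j ∈ Finset.range n, C * volume ((E j \ E (j+1)) ∩ ball (0 : Ed d) 2) := by
          apply Finset.sum_le_sum
          intro j hj
          refine (measure_mono (inter_subset_inter_left _ (hmono (j+1) n ?_))).trans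
            (level_decay hμ hM hw hPM hx0 hwx0 j)
          have := Finset.mem_range.1 hj
          omega
      _ = C * ∑ j ∈ Finset.range n, volume ((E j \ E (j+1)) ∩ ball (0 : Ed d) 2) := by rw [Finset.mul_sum]
      _ ≤ C * volume (ball (0 : Ed d) 2) := by
          gcongr
          exact le_self_add.trans (htel n)
  by_contra hcon
  push Not at hcon
  have h1 : (n : ℝ≥0∞) * volume (ball (0 : Ed d) (1/2)) ≤ 2 * (C * volume (ball (0 : Ed d) 2)) := by
    calc (n : ℝ≥0∞) * volume (ball (0 : Ed d) (1/2)) ≤ n * (2 * volume (E n ∩ ball (0 : Ed d) (1/2))) := by gcongr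
      _ = 2 * (n * volume (E n ∩ ball (0 : Ed d) (1/2))) := by ring
      _ ≤ _ := by gcongr
  have h2 : (n : ℝ≥0∞) ≤ 2 * (C * volume (ball (0 : Ed d) 2)) / volume (ball (0 : Ed d) (1/2)) :=
    (ENNReal.le_div_iff_mul_le (Or.inl hV) (Or.inl hVt)).2 h1
  exact absurd h2 (not_le.2 hn)


lemma vol_affine {d : ℕ} (x0 : Ed d) {s : ℝ} (hs : 0 < s) (S : Set (Ed d)) :
    volume {y : Ed d | x0 + s • y ∈ S} = ENNReal.ofReal ((s ^ d)⁻¹) * volume S := by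
  have h : {y : Ed d | x0 + s • y ∈ S} = (fun y : Ed d => s • y) ⁻¹' ((fun z => x0 + z) ⁻¹' S) := rfl
  rw [h, Measure.addHaar_preimage_smul _ hs.ne', measure_preimage_add, finrank_euclideanSpace_fin,
    abs_of_pos (by positivity)]

lemma lint_affine {d : ℕ} (x0 : Ed d) {s : ℝ} (hs : 0 < s) (F : Ed d → ℝ≥0∞) :
    ∫⁻ y, F (x0 + s • y) = ENNReal.ofReal ((s ^ d)⁻¹) * ∫⁻ y, F y := by
  have h1 : ∫⁻ y, F (x0 + s • y) = ∫⁻ y, F (x0 + y) ∂(Measure.map (fun y : Ed d => s • y) volume) :=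
    (lintegral_map_equiv (fun y => F (x0 + y))
      (Homeomorph.smul (isUnit_iff_ne_zero.2 hs.ne').unit).toMeasurableEquiv).symm
  rw [h1, Measure.map_addHaar_smul _ hs.ne', lintegral_smul_measure, finrank_euclideanSpace_fin,
    abs_of_pos (by positivity), lintegral_add_left_eq_self, smul_eq_mul]

lemma lint_resc {d : ℕ} (x0 : Ed d) {s H δ R : ℝ} (hs : 0 < s) (hH : s ≤ H) {g : Ed d → ℝ}
    (hball : ∀ y : Ed d, ‖y‖ < R → x0 + s • y ∈ ball (0 : Ed d) 1)
    (hg0 : ∀ x ∈ ball (0 : Ed d) 1, 0 ≤ g x)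
    (hg : ∫⁻ y in ball (0 : Ed d) 1, ENNReal.ofReal (g y ^ d) ≤ ENNReal.ofReal δ) :
    ∫⁻ y in ball (0 : Ed d) R, ENNReal.ofReal ((s ^ 2 / H * g (x0 + s • y)) ^ d) ≤ ENNReal.ofReal δ := by
  have hH0 : 0 < H := hs.trans_le hH
  set F : Ed d → ℝ≥0∞ := (ball (0 : Ed d) 1).indicator (fun y => ENNReal.ofReal (g y ^ d)) with hF
  rw [← lintegral_indicator measurableSet_ball]
  have hc : s ^ 2 / H ≤ s := by rw [div_le_iff₀ hH0]; nlinarith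
  have hc0 : 0 ≤ s ^ 2 / H := by positivity
  calc ∫⁻ y, (ball (0 : Ed d) R).indicator (fun y => ENNReal.ofReal ((s ^ 2 / H * g (x0 + s • y)) ^ d)) y
      ≤ ∫⁻ y, ENNReal.ofReal (s ^ d) * F (x0 + s • y) := by
        apply lintegral_mono
        intro y
        by_cases hy : y ∈ ball (0 : Ed d) R
        · have hy' := hball y (by simpa using hy)
          have h0 := hg0 _ hy'
          simp only [hF, indicator_of_mem hy, indicator_of_mem hy']
          rw [← ENNReal.ofReal_mul (by positivity), ← mul_pow]
          apply ENNReal.ofReal_le_ofReal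
          gcongr
        · simp [indicator_of_notMem hy]
    _ = ENNReal.ofReal (s ^ d) * (ENNReal.ofReal ((s ^ d)⁻¹) * ∫⁻ y, F y) := by
        rw [lintegral_const_mul' _ _ ENNReal.ofReal_ne_top, lint_affine x0 hs]
    _ = ∫⁻ y, F y := by
        rw [← mul_assoc, ← ENNReal.ofReal_mul (by positivity), mul_inv_cancel₀ (by positivity)]
        simp
    _ ≤ ENNReal.ofReal δ := by rw [hF, lintegral_indicator measurableSet_ball]; exact hg

set_option maxHeartbeats 1000000 in
lemma one_step {d : ℕ} (hd : 1 ≤ d) {lam Lam C0 : ℝ}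
    (hlam : 0 < lam) (hLam : lam ≤ Lam) (hC0 : 0 ≤ C0) {K : Ed d → ℝ} (hK : KernCond K) :
    ∃ ρ0 δ θ : ℝ, 0 < ρ0 ∧ ρ0 ≤ 1/8 ∧ 0 < δ ∧ 0 < θ ∧ θ ≤ 1 ∧
      ∀ u g : Ed d → ℝ, Continuous u → (∀ x, u x ∈ Icc (-(1/2) : ℝ) (1/2)) →
      SupersolMinus lam Lam C0 K g (ball 0 1) u → ContinuousOn g (ball 0 1) →
      (∀ x ∈ ball (0 : Ed d) 1, 0 ≤ g x) →
      ∫⁻ y in ball (0 : Ed d) 1, ENNReal.ofReal (g y ^ d) ≤ ENNReal.ofReal δ →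
      ∀ ρ H m : ℝ, 0 < ρ → ρ ≤ ρ0 → ρ ≤ H → (∀ y : Ed d, ‖y‖ < 8 → m ≤ u (ρ • y)) →
      (∀ y : Ed d, m - H * ‖y‖ ≤ u (ρ • y)) →
      ∀ x0 : Ed d, ‖x0‖ < 1/2 → u (ρ • x0) ≤ m + H →
      2 * volume ({y : Ed d | m + H / θ < u (ρ • y)} ∩ ball (0 : Ed d) (1/2)) <
        volume (ball (0 : Ed d) (1/2)) := by
  have hLam0 : 0 < Lam := hlam.trans_le hLam
  obtain ⟨ε, δ, μ, M, hε, hδ, hμ, hM, hPM⟩ :=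
    point_measure hd hlam (LD := Lam * d) (by positivity)
  obtain ⟨n, hn⟩ := measure_decay (d := d) hμ hM
  obtain ⟨r0, hr0, hr01, hr0s⟩ := omg_small hK (half_pos hε)
  have hC1 : 0 < 2 * (C0 + 1) := by linarith
  have hq : 0 < ε / (2 * (C0 + 1)) := div_pos hε hC1
  have hMn : 1 ≤ M ^ n := one_le_pow₀ hM.le
  refine ⟨min (min r0 (1/8)) (ε / (2 * (C0 + 1))), δ, (M ^ n)⁻¹, lt_min (lt_min hr0 (by norm_num)) hq,
    (min_le_left _ _).trans (min_le_right _ _), hδ, by positivity, inv_le_one_of_one_le₀ hMn, ?_⟩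
  intro u g hu hbd hsup hgc hg0 hg ρ H m hρ hρ0 hρH hm8 hmg x0 hx0 hux0
  have hρr : ρ ≤ r0 := hρ0.trans ((min_le_left _ _).trans (min_le_left _ _))
  have hρ8 : ρ ≤ 1/8 := hρ0.trans ((min_le_left _ _).trans (min_le_right _ _))
  have hρC : ρ * (2 * (C0 + 1)) ≤ ε := (le_div_iff₀ hC1).1 (hρ0.trans (min_le_right _ _))
  have hH : 0 < H := hρ.trans_le hρH
  have key := hn (fun y => (u (ρ • y) - m) / H) (by fun_prop) ?_ x0 hx0 (by
    rw [div_le_one hH]; linarith)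
  · convert key using 5
    funext y
    apply propext
    rw [lt_div_iff₀ hH, div_inv_eq_mul]
    constructor <;> intro h <;> linarith
  intro x hx r hr hr1 k ⟨xh, hxh, hwxh⟩
  set s := ρ * r with hs
  have hs0 : 0 < s := mul_pos hρ hr
  have hsρ : s ≤ ρ := by rw [hs]; nlinarith
  set H' := H * M ^ k with hH'
  have hMk : 1 ≤ M ^ k := one_le_pow₀ hM.le
  have hHH' : H ≤ H' := by rw [hH']; nlinarith
  have hH'0 : 0 < H' := hH.trans_le hHH'
  have hsH : s ≤ H' := by linarith
  have hnorm : ∀ y : Ed d, ‖x + r • y‖ ≤ 1/2 + ‖y‖ := by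
    intro y
    have h1 := norm_add_le x (r • y)
    rw [norm_smul, Real.norm_of_nonneg hr.le] at h1
    have := norm_nonneg y
    nlinarith
  have hpt : ∀ y : Ed d, ρ • x + s • y = ρ • (x + r • y) := by
    intro y; rw [smul_add, smul_smul]
  have hball : ∀ y : Ed d, ‖y‖ < 5 → ρ • x + s • y ∈ ball (0 : Ed d) 1 := by
    intro y hy
    rw [mem_ball_zero_iff, hpt, norm_smul, Real.norm_of_nonneg hρ.le]
    have := hnorm y
    have := norm_nonneg (x + r • y)
    nlinarith
  have hjet := jetSup_rescale hLam hC0 hK hu hbd hsup (R := 5) (m := m) (x0 := ρ • x) (ε := ε)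
    hs0 (by linarith) hsH (by
      have h1 := hr0s s hs0 (by linarith)
      have h2 : C0 * s ≤ C0 * ρ := mul_le_mul_of_nonneg_left hsρ hC0
      nlinarith) hball
  have hpos6 : ∀ y : Ed d, ‖y‖ ≤ 6 → 0 ≤ (u (ρ • x + s • y) - m) / H' := by
    intro y hy
    have := hm8 (x + r • y) (by have := hnorm y; linarith)
    rw [hpt]
    exact div_nonneg (by linarith) hH'0.le
  have hmain := hPM _ _ (by fun_prop) hpos6 (by
      intro y
      by_cases hy : ‖y‖ ≤ 6
      · have := hpos6 y hy
        have := norm_nonneg y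
        linarith
      · have h1 := hmg (x + r • y)
        have h2 := hnorm y
        rw [hpt, le_div_iff₀ hH'0]
        have h3 : H * ‖x + r • y‖ ≤ H * (4 * ‖y‖) := mul_le_mul_of_nonneg_left (by linarith) hH.le
        have h4 : H * (4 * ‖y‖) ≤ H' * (4 * ‖y‖) := mul_le_mul_of_nonneg_right hHH' (by positivity)
        linarith) hjet (by
      refine ContinuousOn.mul continuousOn_const (hgc.comp (by fun_prop) ?_)
      intro y hy
      exact hball y (by simpa using hy)) (by
      intro y hy
      exact mul_nonneg (by positivity) (hg0 _ (hball y hy)))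
    (lint_resc _ hs0 hsH hball hg0 hg) (r⁻¹ • (xh - x)) (by
      rw [norm_smul, norm_inv, Real.norm_of_nonneg hr.le, inv_mul_le_iff₀ hr]; linarith) (by
      have h1 : ρ • x + s • (r⁻¹ • (xh - x)) = ρ • xh := by
        rw [hpt, smul_smul, mul_inv_cancel₀ hr.ne', one_smul, add_sub_cancel]
      rw [h1, div_le_one hH'0]
      rw [div_le_iff₀ hH] at hwxh
      rw [hH']; linarith)
  have hset : {y : Ed d | (u (ρ • x + s • y) - m) / H' < M} ∩ ball (0 : Ed d) 1 =
      {y : Ed d | x + r • y ∈ {y : Ed d | (u (ρ • y) - m) / H < M ^ (k+1)} ∩ ball x r} := by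
    ext y
    show ((u (ρ • x + s • y) - m) / H' < M ∧ y ∈ ball (0 : Ed d) 1) ↔
      ((u (ρ • (x + r • y)) - m) / H < M ^ (k+1) ∧ x + r • y ∈ ball x r)
    have e1 : y ∈ ball (0 : Ed d) 1 ↔ x + r • y ∈ ball x r := by
      rw [mem_ball_zero_iff, mem_ball_iff_norm, add_sub_cancel_left, norm_smul,
        Real.norm_of_nonneg hr.le]
      constructor <;> intro h <;> nlinarith
    rw [e1, hpt, div_lt_iff₀ hH, div_lt_iff₀ hH'0, hH', pow_succ]
    have e2 : M * (H * M ^ k) = M ^ k * M * H := by ring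
    rw [e2]
  rw [hset, vol_affine x hr] at hmain
  calc ENNReal.ofReal (μ * r ^ d) = ENNReal.ofReal (r ^ d) * ENNReal.ofReal μ := by
        rw [mul_comm, ENNReal.ofReal_mul (by positivity)]
    _ ≤ ENNReal.ofReal (r ^ d) * (ENNReal.ofReal ((r ^ d)⁻¹) * volume ({y : Ed d | (u (ρ • y) - m) / H < M ^ (k+1)} ∩ ball x r)) := by
        gcongr
    _ = _ := by
        rw [← mul_assoc, ← ENNReal.ofReal_mul (by positivity), mul_inv_cancel₀ (by positivity)]
        simp


lemma subsol_neg {d : ℕ} {lam Lam C0 : ℝ} {K g u : Ed d → ℝ} {O : Set (Ed d)}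
    (h : SubsolPlus lam Lam C0 K (fun x => -g x) O u) :
    SupersolMinus lam Lam C0 K g O (fun x => -u x) := by
  intro φ hφ hb x hx hle heq
  have hb' : IsBddFun (fun y => -φ y) := by
    obtain ⟨M, hM⟩ := hb
    exact ⟨M, fun x => by rw [abs_neg]; exact hM x⟩
  have h1 := h (fun y => -φ y) hφ.neg hb' x hx (fun y => by have := hle y; linarith)
    (by have : -u x = φ x := heq
        linarith)
  have hfun : (fun y => -φ y) = -φ := rfl
  have hH : hess (fun y => -φ y) x = -hess φ x := by
    ext i j
    simp only [hess, Matrix.of_apply, Matrix.neg_apply, hfun]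
    rw [iteratedFDeriv_neg_apply]
    rfl
  have hG : gradient (fun y => -φ y) x = -gradient φ x := by
    simp only [gradient, fderiv_fun_neg, map_neg]
  have hP : pucciPlus lam Lam (-hess φ x) = -pucciMinus lam Lam (hess φ x) := by
    unfold pucciPlus pucciMinus
    rw [← Real.sSup_neg]
    congr 1
    ext t
    simp only [mem_image, Set.mem_neg, Matrix.mul_neg, Matrix.trace_neg]
    constructor
    · rintro ⟨A, hA, rfl⟩; exact ⟨A, hA, by simp⟩
    · rintro ⟨A, hA, h⟩; exact ⟨A, hA, by rw [h]; simp⟩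
  have hN : nlPlus K 1 (fun y => -φ y) x = -nlMinus K 1 φ x := by
    unfold nlPlus nlMinus
    rw [neg_neg]
    congr 1
    funext z
    have : deltaOp (fun y => -φ y) 1 x z = -deltaOp φ 1 x z := by
      unfold deltaOp
      rw [hG]
      by_cases hz : z ∈ ball (0 : Ed d) (1/1)
      · simp only [indicator_of_mem hz, inner_neg_left]; ring
      · simp only [indicator_of_notMem hz]; ring
    rw [this]
  rw [hH, hG, hP, hN, norm_neg] at h1
  linarith

/-- Oscillation invariant at scale `ρ`. -/
def OscInv {d : ℕ} (θ : ℝ) (u : Ed d → ℝ) (ρ D m : ℝ) : Prop :=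
  (∀ x : Ed d, ‖x‖ < 8 * ρ → m ≤ u x ∧ u x ≤ m + D) ∧
  (∀ x : Ed d, m - θ / 4 * (D / ρ) * ‖x‖ ≤ u x ∧ u x ≤ m + D + θ / 4 * (D / ρ) * ‖x‖)

lemma osc_next {d : ℕ} {θ : ℝ} (hθ : 0 < θ) (hθ1 : θ ≤ 1) {u : Ed d → ℝ} {ρ D m m' : ℝ} (hρ : 0 < ρ)
    (hD : 0 < D) (h : OscInv θ u ρ D m) (h1 : m ≤ m') (h2 : m' + D / (1 + θ / 8) ≤ m + D)
    (h3 : ∀ x : Ed d, ‖x‖ < 8 * (ρ / 16) → m' ≤ u x ∧ u x ≤ m' + D / (1 + θ / 8)) :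
    OscInv θ u (ρ / 16) (D / (1 + θ / 8)) m' := by
  refine ⟨h3, ?_⟩
  set D' := D / (1 + θ / 8) with hD'
  have ha : 0 < 1 + θ / 8 := by linarith
  have hDD : D = D' * (1 + θ / 8) := by rw [hD', div_mul_cancel₀ _ ha.ne']
  have hD'0 : 0 < D' := div_pos hD ha
  clear_value D'
  intro x
  have hx0 := norm_nonneg x
  have hq : 0 ≤ D' / (ρ / 16) := by positivity
  have hr : 0 ≤ θ / 4 * (D' / (ρ / 16)) * ‖x‖ := by positivity
  by_cases hx : ‖x‖ < 8 * (ρ / 16)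
  · have := h3 x hx
    constructor <;> linarith [this.1, this.2]
  push Not at hx
  have hxρ : 1/2 ≤ ‖x‖ / ρ := by rw [le_div_iff₀ hρ]; linarith
  set t := ‖x‖ / ρ with ht
  have e1 : θ / 4 * (D' / (ρ / 16)) * ‖x‖ = 4 * θ * D' * t := by
    rw [ht]; field_simp; ring
  have e2 : θ / 4 * (D / ρ) * ‖x‖ = θ / 4 * (D' * (1 + θ / 8)) * t := by
    rw [ht, hDD]; field_simp
  have h4 := (h.2 x)
  rw [e2] at h4
  rw [e1]
  have hθD : 0 < θ * D' := mul_pos hθ hD'0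
  have hA : θ / 8 * D' + θ / 4 * (D' * (1 + θ / 8)) * t ≤ 4 * θ * D' * t := by
    have k1 : θ * D' * (1/2) ≤ θ * D' * t := mul_le_mul_of_nonneg_left hxρ hθD.le
    have k2 : θ * D' * t * (θ / 8) ≤ θ * D' * t * 1 := mul_le_mul_of_nonneg_left (by linarith) (by nlinarith)
    nlinarith
  have hDe : D = D' + θ / 8 * D' := by rw [hDD]; ring
  constructor <;> linarith [h4.1, h4.2]

lemma osc_step {d : ℕ} {θ : ℝ} (hθ : 0 < θ) (hθ1 : θ ≤ 1) {u : Ed d → ℝ} {ρ D m : ℝ} (hρ : 0 < ρ)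
    (hD : 0 < D) (h : OscInv θ u ρ D m)
    (hA : ∀ x0 : Ed d, ‖x0‖ < 1/2 → u (ρ • x0) ≤ m + D * θ / 4 →
      2 * volume ({y : Ed d | m + D * θ / 4 / θ < u (ρ • y)} ∩ ball (0 : Ed d) (1/2)) <
        volume (ball (0 : Ed d) (1/2)))
    (hB : ∀ x0 : Ed d, ‖x0‖ < 1/2 → -u (ρ • x0) ≤ -(m + D) + D * θ / 4 →
      2 * volume ({y : Ed d | -(m + D) + D * θ / 4 / θ < -u (ρ • y)} ∩ ball (0 : Ed d) (1/2)) <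
        volume (ball (0 : Ed d) (1/2))) :
    ∃ m', OscInv θ u (ρ / 16) (D / (1 + θ / 8)) m' := by
  have ha : 0 < 1 + θ / 8 := by linarith
  have hDle : D / (1 + θ / 8) ≤ D := div_le_self hD.le (by linarith)
  have hDge : D - D * θ / 4 ≤ D / (1 + θ / 8) := by
    rw [le_div_iff₀ ha]
    have : 0 < D * θ := mul_pos hD hθ
    nlinarith
  have hsub : ∀ x : Ed d, ‖x‖ < 8 * (ρ / 16) → ‖x‖ < 8 * ρ := fun x hx => by linarith
  have hpt : ∀ x : Ed d, ‖x‖ < 8 * (ρ / 16) → ‖ρ⁻¹ • x‖ < 1/2 ∧ ρ • (ρ⁻¹ • x) = x := by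
    intro x hx
    constructor
    · rw [norm_smul, norm_inv, Real.norm_of_nonneg hρ.le, inv_mul_lt_iff₀ hρ]; linarith
    · rw [smul_smul, mul_inv_cancel₀ hρ.ne', one_smul]
  have e4 : D * θ / 4 / θ = D / 4 := by field_simp
  rw [e4] at hA hB
  by_cases hc : ∃ x0 : Ed d, ‖x0‖ < 1/2 ∧ u (ρ • x0) ≤ m + D * θ / 4
  · obtain ⟨x0, hx0, hux⟩ := hc
    have hA' := hA x0 hx0 hux
    refine ⟨m, osc_next hθ hθ1 hρ hD h le_rfl (by linarith) ?_⟩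
    intro x hx
    refine ⟨(h.1 x (hsub x hx)).1, ?_⟩
    by_contra hcon
    push Not at hcon
    obtain ⟨p1, p2⟩ := hpt x hx
    have hB' := hB (ρ⁻¹ • x) p1 (by rw [p2]; linarith)
    set S := {y : Ed d | m + D / 4 < u (ρ • y)} ∩ ball (0 : Ed d) (1/2)
    set T := {y : Ed d | -(m + D) + D / 4 < -u (ρ • y)} ∩ ball (0 : Ed d) (1/2)
    have hcov : ball (0 : Ed d) (1/2) ⊆ S ∪ T := by
      intro y hy
      by_cases hy2 : m + D / 4 < u (ρ • y)
      · exact Or.inl ⟨hy2, hy⟩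
      · exact Or.inr ⟨by show -(m + D) + D / 4 < -u (ρ • y)
                         linarith, hy⟩
    have hle : volume (ball (0 : Ed d) (1/2)) ≤ volume S + volume T :=
      (measure_mono hcov).trans (measure_union_le _ _)
    have h5 : 2 * volume (ball (0 : Ed d) (1/2)) < 2 * volume (ball (0 : Ed d) (1/2)) := by
      calc 2 * volume (ball (0 : Ed d) (1/2)) ≤ 2 * (volume S + volume T) := by gcongr
        _ = 2 * volume S + 2 * volume T := by ring
        _ < volume (ball (0 : Ed d) (1/2)) + volume (ball (0 : Ed d) (1/2)) := ENNReal.add_lt_add hA' hB'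
        _ = _ := by ring
    exact lt_irrefl _ h5
  · push Not at hc
    refine ⟨m + D - D / (1 + θ / 8), osc_next hθ hθ1 hρ hD h (by linarith) (by linarith) ?_⟩
    intro x hx
    obtain ⟨p1, p2⟩ := hpt x hx
    have := hc _ p1
    rw [p2] at this
    have h6 := (h.1 x (hsub x hx)).2
    constructor <;> linarith

lemma lint_part {d : ℕ} (hd : 1 ≤ d) {δ : ℝ} (hδ : 0 < δ) {f g : Ed d → ℝ}
    (hf : IntegrableOn (fun x => |f x| ^ (d : ℝ)) (ball (0 : Ed d) 1))
    (hL : LnormOn (d : ℝ) (ball (0 : Ed d) 1) f ≤ δ ^ (1 / (d : ℝ)))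
    (hg0 : ∀ x, 0 ≤ g x) (hgf : ∀ x, g x ≤ |f x|) :
    ∫⁻ y in ball (0 : Ed d) 1, ENNReal.ofReal (g y ^ d) ≤ ENNReal.ofReal δ := by
  have hd0 : (0 : ℝ) < d := by exact_mod_cast hd
  have hI0 : 0 ≤ ∫ x in ball (0 : Ed d) 1, |f x| ^ (d : ℝ) :=
    integral_nonneg fun x => by positivity
  have hI : ∫ x in ball (0 : Ed d) 1, |f x| ^ (d : ℝ) ≤ δ :=
    (Real.rpow_le_rpow_iff hI0 hδ.le (by positivity)).1 hL
  calc ∫⁻ y in ball (0 : Ed d) 1, ENNReal.ofReal (g y ^ d)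
      ≤ ∫⁻ y in ball (0 : Ed d) 1, ENNReal.ofReal (|f y| ^ (d : ℝ)) := by
        apply lintegral_mono
        intro y
        apply ENNReal.ofReal_le_ofReal
        rw [Real.rpow_natCast]
        exact pow_le_pow_left₀ (hg0 y) (hgf y) d
    _ = ENNReal.ofReal (∫ x in ball (0 : Ed d) 1, |f x| ^ (d : ℝ)) :=
        (ofReal_integral_eq_lintegral_ofReal hf (Filter.Eventually.of_forall fun x => by positivity)).symm
    _ ≤ ENNReal.ofReal δ := ENNReal.ofReal_le_ofReal hI


/-- Hölder estimate for solutions of the two extremal inequalities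
(Theorem 4.1). -/
theorem holder_estimate_extremal {d : ℕ} (hd : 1 ≤ d) (lam Lam C0 : ℝ)
    (hlam : 0 < lam) (hLam : lam ≤ Lam) (hC0 : 0 ≤ C0)
    (K : Ed d → ℝ) (hK : KernCond K) :
    ∃ ε₄ α C : ℝ, 0 < ε₄ ∧ α ∈ Ioo (0 : ℝ) 1 ∧ 0 < C ∧
      ∀ f : Ed d → ℝ, ContinuousOn f (Metric.ball (0 : Ed d) 1) →
        IntegrableOn (fun x => |f x| ^ (d : ℝ)) (Metric.ball (0 : Ed d) 1) →
        LnormOn (d : ℝ) (Metric.ball (0 : Ed d) 1) f ≤ ε₄ →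
      ∀ u : Ed d → ℝ, Continuous u → (∀ x, u x ∈ Icc (-(1/2) : ℝ) (1/2)) →
        SubsolPlus lam Lam C0 K (fun x => -nPart f x) (Metric.ball (0 : Ed d) 1) u →
        SupersolMinus lam Lam C0 K (pPart f) (Metric.ball (0 : Ed d) 1) u →
        ∀ x : Ed d, |u x - u 0| ≤ C * ‖x‖ ^ α := by
  obtain ⟨ρ0, δ, θ, hρ0, hρ08, hδ, hθ, hθ1, hone⟩ := one_step hd hlam hLam hC0 hK
  set b : ℝ := 1 + θ / 8 with hb
  have hb1 : 1 < b := by rw [hb]; linarith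
  have hb0 : 0 < b := by linarith
  have hb2 : b ≤ 2 := by rw [hb]; linarith
  set ρs : ℝ := min ρ0 (θ / 4) with hρs
  have hρs0 : 0 < ρs := lt_min hρ0 (by linarith)
  have hρs1 : ρs ≤ ρ0 := min_le_left _ _
  have hρs2 : ρs ≤ θ / 4 := min_le_right _ _
  set R : ℝ := 4 * ρs with hR
  have hR0 : 0 < R := by rw [hR]; linarith
  have hl16 : 0 < Real.log 16 := Real.log_pos (by norm_num)
  set α : ℝ := Real.log b / Real.log 16 with hα
  have hα0 : 0 < α := div_pos (Real.log_pos hb1) hl16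
  have hα1 : α < 1 := by
    rw [hα, div_lt_one hl16]
    exact Real.log_lt_log hb0 (by linarith)
  have h16 : (16 : ℝ) ^ α = b := by
    rw [Real.rpow_def_of_pos (by norm_num), hα, mul_div_cancel₀ _ hl16.ne', Real.exp_log hb0]
  clear_value b ρs α R
  have hRα : 0 < R ^ α := Real.rpow_pos_of_pos hR0 α
  refine ⟨δ ^ (1 / (d : ℝ)), α, b / R ^ α, Real.rpow_pos_of_pos hδ _, ⟨hα0, hα1⟩, div_pos hb0 hRα, ?_⟩
  intro f hfc hfi hfL u hu hbd hsub hsup x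
  have hu2 : Continuous (fun x => -u x) := hu.neg
  have hbd2 : ∀ x, -u x ∈ Icc (-(1/2) : ℝ) (1/2) := fun x =>
    ⟨by linarith [(hbd x).2], by linarith [(hbd x).1]⟩
  have hone1 := hone u (pPart f) hu hbd hsup (hfc.sup continuousOn_const)
    (fun x _ => le_max_right _ _)
    (lint_part hd hδ hfi hfL (fun x => le_max_right _ _) (fun x => max_le (le_abs_self _) (abs_nonneg _)))
  have hone2 := hone (fun x => -u x) (nPart f) hu2 hbd2 (subsol_neg hsub) (hfc.neg.sup continuousOn_const)
    (fun x _ => le_max_right _ _)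
    (lint_part hd hδ hfi hfL (fun x => le_max_right _ _) (fun x => max_le (neg_le_abs _) (abs_nonneg _)))
  have hind : ∀ k : ℕ, 0 < ρs / 16 ^ k ∧ ρs / 16 ^ k ≤ ρ0 ∧ ρs / 16 ^ k ≤ 1 / b ^ k * θ / 4 ∧
      ∃ m, OscInv θ u (ρs / 16 ^ k) (1 / b ^ k) m := by
    intro k
    induction k with
    | zero =>
      refine ⟨by simpa using hρs0, by simpa using hρs1, by simpa using hρs2, -(1/2), ?_, ?_⟩
      · intro x _
        have := hbd x
        constructor <;> norm_num <;> linarith [this.1, this.2]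
      · intro x
        have := hbd x
        have h0 : 0 ≤ θ / 4 * (1 / b ^ 0 / (ρs / 16 ^ 0)) * ‖x‖ := by
          have := norm_nonneg x
          positivity
        have e : 1 / b ^ 0 = 1 := by simp
        rw [e] at h0 ⊢
        constructor <;> linarith [this.1, this.2]
    | succ k ih =>
      obtain ⟨h1, h2, h3, m, hm⟩ := ih
      have e1 : ρs / 16 ^ (k+1) = ρs / 16 ^ k / 16 := by rw [pow_succ, div_div]
      have e2 : 1 / b ^ (k+1) = 1 / b ^ k / b := by rw [pow_succ, div_div]
      have hD : 0 < 1 / b ^ k := by positivity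
      rw [e1, e2]
      set ρ := ρs / 16 ^ k
      set D := 1 / b ^ k
      clear_value ρ D
      refine ⟨by linarith, by linarith, ?_, ?_⟩
      · have : D / 16 ≤ D / b := div_le_div_of_nonneg_left hD.le hb0 (by linarith)
        nlinarith
      · rw [hb]
        apply osc_step hθ hθ1 h1 hD hm
        · intro x0 hx0 hux
          refine hone1 ρ (D * θ / 4) m h1 h2 h3 ?_ ?_ x0 hx0 hux
          · intro y hy
            refine (hm.1 (ρ • y) ?_).1
            rw [norm_smul, Real.norm_of_nonneg h1.le]; nlinarith
          · intro y
            have := (hm.2 (ρ • y)).1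
            rw [norm_smul, Real.norm_of_nonneg h1.le] at this
            have e : θ / 4 * (D / ρ) * (ρ * ‖y‖) = D * θ / 4 * ‖y‖ := by field_simp
            rwa [e] at this
        · intro x0 hx0 hux
          refine hone2 ρ (D * θ / 4) (-(m + D)) h1 h2 h3 ?_ ?_ x0 hx0 hux
          · intro y hy
            have := (hm.1 (ρ • y) (by rw [norm_smul, Real.norm_of_nonneg h1.le]; nlinarith)).2
            linarith
          · intro y
            have := (hm.2 (ρ • y)).2
            rw [norm_smul, Real.norm_of_nonneg h1.le] at this
            have e : θ / 4 * (D / ρ) * (ρ * ‖y‖) = D * θ / 4 * ‖y‖ := by field_simp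
            rw [e] at this
            linarith
  rcases eq_or_ne x 0 with rfl | hx
  · simp only [sub_self, abs_zero]
    positivity
  have hxn : 0 < ‖x‖ := norm_pos_iff.2 hx
  have hxα : 0 < ‖x‖ ^ α := Real.rpow_pos_of_pos hxn α
  rw [div_mul_eq_mul_div, le_div_iff₀ hRα]
  by_cases hxR : R ≤ ‖x‖
  · have h1 : |u x - u 0| ≤ 1 := by
      rw [abs_le]
      constructor <;> linarith [(hbd x).1, (hbd x).2, (hbd 0).1, (hbd 0).2]
    have h2 : R ^ α ≤ ‖x‖ ^ α := Real.rpow_le_rpow hR0.le hxR hα0.le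
    calc |u x - u 0| * R ^ α ≤ 1 * ‖x‖ ^ α := mul_le_mul h1 h2 hRα.le zero_le_one
      _ ≤ b * ‖x‖ ^ α := mul_le_mul_of_nonneg_right hb1.le hxα.le
  · push Not at hxR
    obtain ⟨k, hk1, hk2⟩ := exists_nat_pow_near (x := R / ‖x‖) (y := 16)
      ((one_le_div hxn).2 hxR.le) (by norm_num)
    obtain ⟨h1, h2, h3, m, hm⟩ := hind k
    have hp16 : (0 : ℝ) < 16 ^ k := by positivity
    have hin : ‖x‖ < 8 * (ρs / 16 ^ k) := by
      rw [le_div_iff₀ hxn] at hk1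
      have : ‖x‖ ≤ 4 * (ρs / 16 ^ k) := by
        rw [← mul_div_assoc, le_div_iff₀ hp16]; linarith
      linarith
    have a1 := hm.1 x hin
    have a2 := hm.1 0 (by rw [norm_zero]; linarith)
    have hosc : |u x - u 0| ≤ 1 / b ^ k := by
      rw [abs_le]
      constructor <;> linarith [a1.1, a1.2, a2.1, a2.2]
    have hpow : R ^ α / ‖x‖ ^ α ≤ b ^ (k+1) := by
      rw [← Real.div_rpow hR0.le hxn.le, ← h16, ← Real.rpow_natCast, ← Real.rpow_mul (by norm_num),
        mul_comm α, Real.rpow_mul (by norm_num), Real.rpow_natCast]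
      exact Real.rpow_le_rpow (by positivity) hk2.le hα0.le
    rw [div_le_iff₀ hxα] at hpow
    have hbk : 0 < b ^ k := by positivity
    calc |u x - u 0| * R ^ α ≤ 1 / b ^ k * (b ^ (k+1) * ‖x‖ ^ α) :=
          mul_le_mul hosc hpow hRα.le (by positivity)
      _ = b * ‖x‖ ^ α := by rw [pow_succ]; field_simp
end
end

section
/- (Boundary barrier) For any 0 < r < 1 there exist constants ε₅ > 0 and 0 < δ₁ < 1, and a Lipschitz function ψ_r : ℝ^d → ℝ with Lipschitz constant 1/r, such that: ψ_r ≡ 0 on the closed ball B̄_r; ψ_r > 0 on the complement of B̄_r; ψ_r ≥ ε₅ on the complement of B_{(1+δ₁)r}; ψ_r is C² on the open annulus B_{(1+δ₁)r} \ B̄_r; and P⁺(D²ψ_r)(x) + P⁺_K(ψ_r)(x) + C₀|Dψ_r(x)| ≤ −1 for every x ∈ B_{(1+δ₁)r} \ B̄_r. -/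
open MeasureTheory Metric Set
open scoped RealInnerProductSpace ENNReal

noncomputable section

lemma bb_Hcont {d : ℕ} (m : Ed d → ℝ) (hm : Integrable m) (hm0 : m 0 = 0) :
    Continuous (fun p : ℝ => ∫ z, m z * (max p 0 / (max p 0 + min ‖z‖ 1))) := by
  have hτ : ∀ z : Ed d, 0 ≤ min ‖z‖ 1 := fun z => le_min (norm_nonneg z) zero_le_one
  have hfrac : ∀ (p : ℝ) (z : Ed d), |max p 0 / (max p 0 + min ‖z‖ 1)| ≤ 1 := by
    intro p z
    have h1 : 0 ≤ max p 0 := le_max_right _ _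
    have := hτ z
    rw [abs_of_nonneg (by positivity)]
    exact div_le_one_of_le₀ (by linarith) (by positivity)
  apply continuous_of_dominated (bound := fun z => |m z|)
  · intro p
    apply hm.aestronglyMeasurable.mul
    exact Measurable.aestronglyMeasurable (by fun_prop)
  · intro p
    refine Filter.Eventually.of_forall fun z => ?_
    rw [norm_mul, Real.norm_eq_abs, Real.norm_eq_abs]
    exact mul_le_of_le_one_right (abs_nonneg _) (hfrac p z)
  · exact hm.abs
  · refine Filter.Eventually.of_forall fun z => ?_
    by_cases hz : z = 0
    · subst hz; simp only [hm0, zero_mul]; exact continuous_const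
    · have hp : 0 < min ‖z‖ 1 := lt_min (norm_pos_iff.2 hz) one_pos
      refine continuous_const.mul (Continuous.div (by fun_prop) (by fun_prop) ?_)
      intro p
      have h1 : 0 ≤ max p 0 := le_max_right _ _
      positivity

lemma bb_Jbound {d : ℕ} (p q : ℝ) (hp : 0 < p) (hq : p / 2 ≤ q) (z : Ed d) :
    |min ‖z‖ 1 / (q + min ‖z‖ 1) ^ 2| ≤ 2 / p := by
  have hτ : 0 ≤ min ‖z‖ 1 := le_min (norm_nonneg z) zero_le_one
  set τ := min ‖z‖ 1
  have : 0 < q := by linarith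
  rw [abs_of_nonneg (by positivity), div_le_div_iff₀ (by positivity) hp]
  nlinarith [mul_nonneg hτ this.le, mul_nonneg hτ hp.le, sq_nonneg q, sq_nonneg τ]

lemma bb_Hder {d : ℕ} (m : Ed d → ℝ) (hm : Integrable m) (p : ℝ) (hp : 0 < p) :
    Integrable (fun z => m z * (min ‖z‖ 1 / (p + min ‖z‖ 1) ^ 2)) ∧
    HasDerivAt (fun p : ℝ => ∫ z, m z * (max p 0 / (max p 0 + min ‖z‖ 1)))
      (∫ z, m z * (min ‖z‖ 1 / (p + min ‖z‖ 1) ^ 2)) p := by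
  have hτ : ∀ z : Ed d, 0 ≤ min ‖z‖ 1 := fun z => le_min (norm_nonneg z) zero_le_one
  have hfrac : ∀ (p : ℝ) (z : Ed d), |max p 0 / (max p 0 + min ‖z‖ 1)| ≤ 1 := by
    intro p z
    have h1 : 0 ≤ max p 0 := le_max_right _ _
    have := hτ z
    rw [abs_of_nonneg (by positivity)]
    exact div_le_one_of_le₀ (by linarith) (by positivity)
  have hmeas : ∀ p : ℝ, AEStronglyMeasurable
      (fun z => m z * (max p 0 / (max p 0 + min ‖z‖ 1))) volume := by
    intro p
    apply hm.aestronglyMeasurable.mul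
    exact Measurable.aestronglyMeasurable (by fun_prop)
  refine hasDerivAt_integral_of_dominated_loc_of_deriv_le
    (F := fun (p : ℝ) (z : Ed d) => m z * (max p 0 / (max p 0 + min ‖z‖ 1)))
    (F' := fun (p : ℝ) (z : Ed d) => m z * (min ‖z‖ 1 / (p + min ‖z‖ 1) ^ 2))
    (bound := fun z => |m z| * (2 / p)) (s := Ioi (p / 2))
    (Ioi_mem_nhds (by linarith)) (Filter.Eventually.of_forall hmeas) ?_ ?_ ?_ ?_ ?_
  · refine hm.abs.mono' (hmeas p) (Filter.Eventually.of_forall fun z => ?_)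
    rw [norm_mul, Real.norm_eq_abs, Real.norm_eq_abs]
    exact mul_le_of_le_one_right (abs_nonneg _) (hfrac p z)
  · apply hm.aestronglyMeasurable.mul
    exact Measurable.aestronglyMeasurable (by fun_prop)
  · refine Filter.Eventually.of_forall fun z q hq => ?_
    rw [norm_mul, Real.norm_eq_abs, Real.norm_eq_abs]
    exact mul_le_mul_of_nonneg_left (bb_Jbound p q hp (le_of_lt hq) z) (abs_nonneg _)
  · exact hm.abs.mul_const _
  · refine Filter.Eventually.of_forall fun z q hq => ?_
    have hq0 : 0 < q := by have : p / 2 < q := hq; linarith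
    have := hτ z
    have hne : q + min ‖z‖ 1 ≠ 0 := by positivity
    have h1 : HasDerivAt (fun q : ℝ => q / (q + min ‖z‖ 1))
        (min ‖z‖ 1 / (q + min ‖z‖ 1) ^ 2) q := by
      have := (hasDerivAt_id q).div ((hasDerivAt_id q).add_const (min ‖z‖ 1)) hne
      have e : min ‖z‖ 1 / (q + min ‖z‖ 1) ^ 2
          = (1 * (id q + min ‖z‖ 1) - id q * 1) / (id q + min ‖z‖ 1) ^ 2 := by simp
      rw [e]
      exact this
    refine (h1.congr_of_eventuallyEq ?_).const_mul (m z)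
    filter_upwards [Ioi_mem_nhds hq0] with y hy
    rw [max_eq_left (le_of_lt hy)]

lemma bb_Jcont {d : ℕ} (m : Ed d → ℝ) (hm : Integrable m) :
    ContinuousOn (fun p : ℝ => ∫ z, m z * (min ‖z‖ 1 / (p + min ‖z‖ 1) ^ 2)) (Ioi 0) := by
  intro p hp
  have hp : 0 < p := hp
  apply ContinuousAt.continuousWithinAt
  apply continuousAt_of_dominated (bound := fun z => |m z| * (2 / p))
  · refine Filter.Eventually.of_forall fun q => ?_
    apply hm.aestronglyMeasurable.mul
    exact Measurable.aestronglyMeasurable (by fun_prop)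
  · filter_upwards [Ioi_mem_nhds (show p / 2 < p by linarith)] with q hq
    refine Filter.Eventually.of_forall fun z => ?_
    rw [norm_mul, Real.norm_eq_abs, Real.norm_eq_abs]
    exact mul_le_mul_of_nonneg_left (bb_Jbound p q hp (le_of_lt hq) z) (abs_nonneg _)
  · exact hm.abs.mul_const _
  · refine Filter.Eventually.of_forall fun z => ?_
    have hτ : 0 ≤ min ‖z‖ 1 := le_min (norm_nonneg z) zero_le_one
    refine continuousAt_const.mul (ContinuousAt.div (by fun_prop) (by fun_prop) ?_)
    positivity

/-- The one-dimensional profile. -/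
lemma bb_profile {d : ℕ} (m : Ed d → ℝ) (hm : Integrable m) (hm0 : m 0 = 0) (hmn : ∀ z, 0 ≤ m z)
    (M C : ℝ) (hM : 0 ≤ M) (hC : 0 ≤ C) :
    ∃ F Fp : ℝ → ℝ, F 0 = 0 ∧ Fp 0 = 1 / 4 ∧ Continuous Fp ∧ (∀ p, HasDerivAt F (Fp p) p) ∧
      (∀ p > 0, HasDerivAt Fp
        (-M - C * ∫ z, m z * (min ‖z‖ 1 / (p + min ‖z‖ 1) ^ 2)) p) ∧
      AntitoneOn Fp (Ici 0) ∧ ContDiffOn ℝ 2 F (Ioi 0) := by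
  set H : ℝ → ℝ := fun p : ℝ => ∫ z, m z * (max p 0 / (max p 0 + min ‖z‖ 1)) with hH
  have hHc : Continuous H := bb_Hcont m hm hm0
  set Fp : ℝ → ℝ := fun p => 1 / 4 - M * p - C * H p with hFp
  have hFpc : Continuous Fp := by fun_prop
  have hF : ∀ p, HasDerivAt (fun u => ∫ t in (0:ℝ)..u, Fp t) (Fp p) p := fun p =>
    intervalIntegral.integral_hasDerivAt_right (hFpc.intervalIntegrable _ _)
      (hFpc.stronglyMeasurableAtFilter _ _) hFpc.continuousAt
  have hd : ∀ p > 0, HasDerivAt Fp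
        (-M - C * ∫ z, m z * (min ‖z‖ 1 / (p + min ‖z‖ 1) ^ 2)) p := by
    intro p hp
    have h := ((((hasDerivAt_id p).const_mul M).const_sub (1 / 4)).sub
      ((bb_Hder m hm p hp).2.const_mul C))
    rw [mul_one] at h
    exact h
  refine ⟨fun u => ∫ t in (0:ℝ)..u, Fp t, Fp, by simp, by simp [hFp, hH], hFpc, hF, hd, ?_, ?_⟩
  · apply antitoneOn_of_deriv_nonpos (convex_Ici 0) hFpc.continuousOn
    · intro p hp
      rw [interior_Ici] at hp
      exact (hd p hp).differentiableAt.differentiableWithinAt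
    · intro p hp
      rw [interior_Ici] at hp
      have hp : 0 < p := hp
      rw [(hd p hp).deriv]
      have : 0 ≤ ∫ z, m z * (min ‖z‖ 1 / (p + min ‖z‖ 1) ^ 2) := by
        apply integral_nonneg
        intro z
        have hτ : 0 ≤ min ‖z‖ 1 := le_min (norm_nonneg z) zero_le_one
        have := hmn z
        show 0 ≤ m z * (min ‖z‖ 1 / (p + min ‖z‖ 1) ^ 2)
        positivity
      nlinarith [mul_nonneg hC this]
  · rw [show (2 : WithTop ℕ∞) = 1 + 1 by norm_num,
      contDiffOn_succ_iff_deriv_of_isOpen isOpen_Ioi]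
    refine ⟨fun p _ => (hF p).differentiableAt.differentiableWithinAt, by simp, ?_⟩
    have : deriv (fun u => ∫ t in (0:ℝ)..u, Fp t) = Fp := funext fun p => (hF p).deriv
    rw [this, show (1 : WithTop ℕ∞) = 0 + 1 by norm_num,
      contDiffOn_succ_iff_deriv_of_isOpen isOpen_Ioi]
    refine ⟨fun p hp => (hd p hp).differentiableAt.differentiableWithinAt, by simp, ?_⟩
    rw [contDiffOn_zero]
    refine (ContinuousOn.congr (f := fun p : ℝ =>
      -M - C * ∫ z, m z * (min ‖z‖ 1 / (p + min ‖z‖ 1) ^ 2)) ?_ fun p hp => (hd p hp).deriv)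
    exact continuousOn_const.sub (continuousOn_const.mul (bb_Jcont m hm))

lemma bb_concave (F Fp : ℝ → ℝ) (hF : ∀ p, HasDerivAt F (Fp p) p) (ha : AntitoneOn Fp (Ici 0))
    (p q : ℝ) (hp : 0 ≤ p) (hq : 0 ≤ q) : F q ≤ F p + Fp p * (q - p) := by
  have hFc : Continuous F := continuous_iff_continuousAt.2 fun p => (hF p).continuousAt
  have hFd : Differentiable ℝ F := fun p => (hF p).differentiableAt
  rcases le_total p q with h | h
  · have := Convex.image_sub_le_mul_sub_of_deriv_le (convex_Icc p q) hFc.continuousOn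
      hFd.differentiableOn (C := Fp p) (fun x hx => by
        rw [interior_Icc] at hx
        rw [(hF x).deriv]
        exact ha hp (hp.trans hx.1.le) hx.1.le) p (left_mem_Icc.2 h) q (right_mem_Icc.2 h) h
    linarith
  · have := Convex.mul_sub_le_image_sub_of_le_deriv (convex_Icc q p) hFc.continuousOn
      hFd.differentiableOn (C := Fp p) (fun x hx => by
        rw [interior_Icc] at hx
        rw [(hF x).deriv]
        exact ha (hq.trans hx.1.le) hp hx.2.le) q (left_mem_Icc.2 h) p (right_mem_Icc.2 h) h
    linarith

lemma bb_grad {d : ℕ} (F Fp : ℝ → ℝ) (hF : ∀ p, HasDerivAt F (Fp p) p) (r : ℝ) (y : Ed d) :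
    HasFDerivAt (fun y : Ed d => F (‖y‖ ^ 2 - r ^ 2))
      ((2 * Fp (‖y‖ ^ 2 - r ^ 2)) • innerSL ℝ y) y := by
  have h1 : HasFDerivAt (fun y : Ed d => ‖y‖ ^ 2 - r ^ 2) (2 • innerSL ℝ y) y :=
    (hasStrictFDerivAt_norm_sq y).hasFDerivAt.sub_const _
  have h2 := (hF (‖y‖ ^ 2 - r ^ 2)).comp_hasFDerivAt y h1
  have e : (2 * Fp (‖y‖ ^ 2 - r ^ 2)) • innerSL ℝ y
      = Fp (‖y‖ ^ 2 - r ^ 2) • (2 • innerSL ℝ y : Ed d →L[ℝ] ℝ) := by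
    ext v
    simp
    ring
  rw [e]
  exact h2

lemma bb_hess {d : ℕ} (F Fp : ℝ → ℝ) (hF : ∀ p, HasDerivAt F (Fp p) p) (r : ℝ) (ψ : Ed d → ℝ)
    (x : Ed d) (hψ : ψ =ᶠ[nhds x] fun y : Ed d => F (‖y‖ ^ 2 - r ^ 2)) (D : ℝ)
    (hD : HasDerivAt Fp D (‖x‖ ^ 2 - r ^ 2)) :
    hess ψ x = (4 * D) • Matrix.vecMulVec (x : Fin d → ℝ) (x : Fin d → ℝ)
      + (2 * Fp (‖x‖ ^ 2 - r ^ 2)) • (1 : Matrix (Fin d) (Fin d) ℝ) := by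
  have hfd : fderiv ℝ ψ =ᶠ[nhds x] fun y => (2 * Fp (‖y‖ ^ 2 - r ^ 2)) • innerSL ℝ y := by
    refine hψ.fderiv.trans (Filter.Eventually.of_forall fun y => ?_)
    exact (bb_grad F Fp hF r y).fderiv
  have h1 : HasFDerivAt (fun y : Ed d => ‖y‖ ^ 2 - r ^ 2) (2 • innerSL ℝ x) x :=
    (hasStrictFDerivAt_norm_sq x).hasFDerivAt.sub_const _
  have h2 := (hD.comp_hasFDerivAt x h1).const_mul 2
  have h3 : HasFDerivAt (fun y : Ed d => (innerSL ℝ y : Ed d →L[ℝ] ℝ)) (innerSL ℝ) x :=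
    (innerSL ℝ : Ed d →L[ℝ] Ed d →L[ℝ] ℝ).hasFDerivAt
  have h4 := (h2.smul h3).congr_of_eventuallyEq hfd
  ext i j
  simp only [hess, Matrix.of_apply, iteratedFDeriv_two_apply, h4.fderiv]
  simp [Matrix.vecMulVec_apply, Matrix.one_apply, EuclideanSpace.inner_single_right]
  have hin : ((innerSL ℝ) (EuclideanSpace.single i (1:ℝ) : Ed d)) (EuclideanSpace.single j (1:ℝ)) = if i = j then 1 else 0 := by
    rw [innerSL_apply_apply]; simp [EuclideanSpace.inner_single_right, eq_comm]
  by_cases hij : i = j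
  · subst hij; simp only [if_true] at hin ⊢; erw [hin]; ring
  · simp only [hij, if_false] at hin ⊢; erw [hin]; ring

lemma bb_pucci {d : ℕ} (lam Lam : ℝ) (hLam : lam ≤ Lam) (x : Ed d) (D e : ℝ)
    (hD : D ≤ 0) (he : 0 ≤ e) :
    pucciPlus lam Lam (D • Matrix.vecMulVec (x : Fin d → ℝ) (x : Fin d → ℝ)
      + e • (1 : Matrix (Fin d) (Fin d) ℝ)) ≤ D * (lam * ‖x‖ ^ 2) + e * (Lam * d) := by
  apply csSup_le
  · refine Set.Nonempty.image _ ⟨lam • 1, ?_, ?_, ?_⟩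
    · simp [Matrix.IsSymm]
    · simp [Matrix.PosSemidef.zero]
    · rw [← sub_smul]
      exact Matrix.PosSemidef.one.smul (by linarith)
  · rintro _ ⟨A, ⟨_, hA1, hA2⟩, rfl⟩
    have h1 := hA1.dotProduct_mulVec_nonneg (x : Fin d → ℝ)
    have h2 := hA2.trace_nonneg
    have hx : ‖x‖ ^ 2 = (x : Fin d → ℝ) ⬝ᵥ (x : Fin d → ℝ) := by
      rw [EuclideanSpace.real_norm_sq_eq]; simp [dotProduct, sq]
    simp only [star_trivial, Matrix.sub_mulVec, Matrix.smul_mulVec, Matrix.one_mulVec,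
      dotProduct_sub, dotProduct_smul, smul_eq_mul, ← hx] at h1
    simp only [Matrix.trace_sub, Matrix.trace_smul, Matrix.trace_one, Fintype.card_fin,
      smul_eq_mul] at h2
    have h3 : (A * Matrix.vecMulVec (x : Fin d → ℝ) (x : Fin d → ℝ)).trace
        = (x : Fin d → ℝ) ⬝ᵥ A.mulVec (x : Fin d → ℝ) := by
      rw [Matrix.mul_vecMulVec, Matrix.trace_vecMulVec, dotProduct_comm]
    simp only [mul_add, Matrix.mul_smul, Matrix.trace_add, Matrix.trace_smul, h3, mul_one,
      smul_eq_mul]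
    nlinarith [mul_nonneg (neg_nonneg.2 hD) h1, mul_nonneg he h2]

/-- The barrier. -/
def bbPsi {d : ℕ} (F : ℝ → ℝ) (r R : ℝ) (x : Ed d) : ℝ := F ((min (max ‖x‖ r) R) ^ 2 - r ^ 2)

lemma bb_psi_eq {d : ℕ} (F : ℝ → ℝ) (r R : ℝ) (x : Ed d) (h1 : r ≤ ‖x‖) (h2 : ‖x‖ ≤ R) :
    bbPsi F r R x = F (‖x‖ ^ 2 - r ^ 2) := by
  rw [bbPsi, max_eq_left h1, min_eq_left h2]

lemma bb_psi_in {d : ℕ} (F : ℝ → ℝ) (r R : ℝ) (hR : r ≤ R) (hF0 : F 0 = 0) (x : Ed d)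
    (h1 : ‖x‖ ≤ r) : bbPsi F r R x = 0 := by
  rw [bbPsi, max_eq_right h1, min_eq_left hR, sub_self, hF0]

lemma bb_psi_ev {d : ℕ} (F : ℝ → ℝ) (r R : ℝ) (x : Ed d) (h1 : r < ‖x‖) (h2 : ‖x‖ < R) :
    bbPsi F r R =ᶠ[nhds x] fun y : Ed d => F (‖y‖ ^ 2 - r ^ 2) := by
  have hc : Continuous (fun y : Ed d => ‖y‖) := continuous_norm
  filter_upwards [hc.continuousAt.preimage_mem_nhds (Ioo_mem_nhds h1 h2)] with y hy
  exact bb_psi_eq F r R y hy.1.le hy.2.le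

lemma bb_gradient {d : ℕ} (F Fp : ℝ → ℝ) (hF : ∀ p, HasDerivAt F (Fp p) p) (r R : ℝ) (x : Ed d)
    (h1 : r < ‖x‖) (h2 : ‖x‖ < R) :
    gradient (bbPsi F r R) x = (2 * Fp (‖x‖ ^ 2 - r ^ 2)) • x := by
  have h := (bb_grad F Fp hF r x).congr_of_eventuallyEq (bb_psi_ev F r R x h1 h2)
  apply HasGradientAt.gradient
  rw [hasGradientAt_iff_hasFDerivAt]
  have e : (InnerProductSpace.toDual ℝ (Ed d)) ((2 * Fp (‖x‖ ^ 2 - r ^ 2)) • x)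
      = (2 * Fp (‖x‖ ^ 2 - r ^ 2)) • innerSL ℝ x := by
    ext v
    simp
  rw [e]
  exact h

lemma bb_lip {d : ℕ} (F Fp : ℝ → ℝ) (hF : ∀ p, HasDerivAt F (Fp p) p) (ha : AntitoneOn Fp (Ici 0))
    (hF0 : Fp 0 = 1 / 4) (r R : ℝ) (hr : 0 < r) (hr1 : r < 1) (hR1 : r < R) (hR2 : R ≤ 2 * r)
    (hpos : ∀ p, 0 ≤ p → p ≤ R ^ 2 - r ^ 2 → 0 < Fp p) :
    LipschitzWith (Real.toNNReal (1 / r)) (bbPsi F r R : Ed d → ℝ) := by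
  have key : ∀ x y : Ed d, bbPsi F r R x - bbPsi F r R y ≤ ‖x - y‖ := by
    intro x y
    unfold bbPsi
    set u := min (max ‖x‖ r) R with hu
    set v := min (max ‖y‖ r) R with hv
    have hu1 : r ≤ u := le_min (le_max_right _ _) hR1.le
    have hv1 : r ≤ v := le_min (le_max_right _ _) hR1.le
    have hu2 : u ≤ R := min_le_right _ _
    have hv2 : v ≤ R := min_le_right _ _
    have huv : |u - v| ≤ ‖x - y‖ := by
      refine le_trans ?_ (abs_norm_sub_norm_le x y)
      refine (abs_min_sub_min_le_max _ _ _ _).trans ?_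
      rw [sub_self, abs_zero, max_eq_left (abs_nonneg _)]
      refine (abs_max_sub_max_le_max _ _ _ _).trans ?_
      rw [sub_self, abs_zero, max_eq_left (abs_nonneg _)]
    have hv3 : 0 ≤ v ^ 2 - r ^ 2 := by nlinarith
    have hv4 : v ^ 2 - r ^ 2 ≤ R ^ 2 - r ^ 2 := by nlinarith
    have hc := bb_concave F Fp hF ha (v ^ 2 - r ^ 2) (u ^ 2 - r ^ 2) hv3 (by nlinarith)
    have hp := hpos _ hv3 hv4
    have hq : Fp (v ^ 2 - r ^ 2) ≤ 1 / 4 := by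
      rw [← hF0]; exact ha (self_mem_Ici) hv3 hv3
    have h5 : u ^ 2 - v ^ 2 ≤ 4 * ‖x - y‖ := by
      have : u ^ 2 - v ^ 2 = (u + v) * (u - v) := by ring
      rw [this]
      have h6 := le_abs_self (u - v)
      have h7 : (u + v) * (u - v) ≤ (u + v) * ‖x - y‖ :=
        mul_le_mul_of_nonneg_left (h6.trans huv) (by linarith)
      have h8 : (u + v) * ‖x - y‖ ≤ 4 * ‖x - y‖ :=
        mul_le_mul_of_nonneg_right (by linarith) (norm_nonneg _)
      linarith
    have h9 := norm_nonneg (x - y)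
    rcases le_total (u ^ 2 - v ^ 2) 0 with h | h <;> nlinarith
  apply LipschitzWith.of_dist_le_mul
  intro x y
  rw [Real.coe_toNNReal _ (by positivity), Real.dist_eq, dist_eq_norm]
  have h1 : ‖x - y‖ ≤ 1 / r * ‖x - y‖ := by
    apply le_mul_of_one_le_left (norm_nonneg _)
    rw [le_div_iff₀ hr]; linarith
  refine le_trans ?_ h1
  rw [abs_le]
  have := key x y
  have := key y x
  rw [norm_sub_rev] at this
  constructor <;> linarith

lemma bb_delta {d : ℕ} (F Fp : ℝ → ℝ) (hF : ∀ p, HasDerivAt F (Fp p) p)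
    (ha : AntitoneOn Fp (Ici 0)) (hFz : F 0 = 0)
    (hF0 : Fp 0 = 1 / 4) (r R : ℝ) (hr : 0 < r) (hr1 : r < 1) (hR1 : r < R) (hR2 : R ≤ 2 * r)
    (hpos : ∀ p, 0 ≤ p → p ≤ R ^ 2 - r ^ 2 → 0 < Fp p) (x z : Ed d)
    (h1 : r < ‖x‖) (h2 : ‖x‖ < R) :
    max (deltaOp (bbPsi F r R) 1 x z) 0 ≤ min (‖z‖ ^ 2) 1 *
      (1 + 16 * (min ‖z‖ 1 / (‖x‖ ^ 2 - r ^ 2 + min ‖z‖ 1) ^ 2)) := by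
  have hτ : 0 ≤ min ‖z‖ 1 := le_min (norm_nonneg z) zero_le_one
  have hm : 0 ≤ min (‖z‖ ^ 2) 1 := le_min (by positivity) zero_le_one
  have hp0 : 0 < ‖x‖ ^ 2 - r ^ 2 := by nlinarith
  have hpR : ‖x‖ ^ 2 - r ^ 2 ≤ R ^ 2 - r ^ 2 := by nlinarith
  have hfrac : 0 ≤ min ‖z‖ 1 / (‖x‖ ^ 2 - r ^ 2 + min ‖z‖ 1) ^ 2 := by positivity
  apply max_le _ (by positivity)
  unfold deltaOp
  rw [bb_gradient F Fp hF r R x h1 h2, bb_psi_eq F r R x h1.le h2.le]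
  have hp : 0 < Fp (‖x‖ ^ 2 - r ^ 2) := hpos _ hp0.le hpR
  have hq : Fp (‖x‖ ^ 2 - r ^ 2) ≤ 1 / 4 := by
    rw [← hF0]; exact ha (self_mem_Ici) hp0.le hp0.le
  have hFx : 0 ≤ F (‖x‖ ^ 2 - r ^ 2) := by
    have := bb_concave F Fp hF ha (‖x‖ ^ 2 - r ^ 2) 0 hp0.le le_rfl
    rw [hFz] at this
    nlinarith
  by_cases hz : ‖z‖ < 1
  · rw [indicator_of_mem (by simpa using hz), min_eq_left hz.le,
      min_eq_left (by nlinarith [norm_nonneg z])]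
    rw [min_eq_left hz.le] at hfrac
    rw [inner_smul_left]
    simp only [conj_trivial]
    rcases le_total ‖x + z‖ r with hy | hy
    · rw [bb_psi_in F r R hR1.le hFz _ hy]
      have hin : -⟪x, z⟫ ≤ ‖x‖ * ‖z‖ := by
        have := abs_real_inner_le_norm x z
        rw [abs_le] at this
        linarith
      have htri : ‖x‖ ≤ r + ‖z‖ := by
        have h := norm_sub_le (x + z) z
        rw [add_sub_cancel_right] at h
        linarith
      have hzp : 0 < ‖z‖ := by linarith
      have hp3 : ‖x‖ ^ 2 - r ^ 2 ≤ 3 * ‖z‖ := by nlinarith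
      have hz1 : -(2 * Fp (‖x‖ ^ 2 - r ^ 2) * ⟪x, z⟫) ≤ ‖z‖ := by
        have hA : 2 * Fp (‖x‖ ^ 2 - r ^ 2) * (-⟪x, z⟫)
            ≤ 2 * Fp (‖x‖ ^ 2 - r ^ 2) * (‖x‖ * ‖z‖) :=
          mul_le_mul_of_nonneg_left hin (by linarith)
        have hB : 2 * Fp (‖x‖ ^ 2 - r ^ 2) * (‖x‖ * ‖z‖) ≤ (1 / 2) * (2 * ‖z‖) := by
          apply mul_le_mul (by linarith) _ (by positivity) (by norm_num)
          exact mul_le_mul_of_nonneg_right (by linarith) hzp.le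
        linarith
      have hfr : 1 / ‖z‖ ≤ 16 * (‖z‖ / (‖x‖ ^ 2 - r ^ 2 + ‖z‖) ^ 2) := by
        rw [← mul_div_assoc, div_le_div_iff₀ hzp (by positivity)]
        nlinarith
      have : ‖z‖ ≤ ‖z‖ ^ 2 * (1 + 16 * (‖z‖ / (‖x‖ ^ 2 - r ^ 2 + ‖z‖) ^ 2)) := by
        calc ‖z‖ = ‖z‖ ^ 2 * (1 / ‖z‖) := by field_simp
          _ ≤ _ := mul_le_mul_of_nonneg_left (by linarith) (by positivity)
      linarith
    · have hex : ‖x + z‖ ^ 2 = ‖x‖ ^ 2 + 2 * ⟪x, z⟫ + ‖z‖ ^ 2 := norm_add_sq_real x z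
      have hle : bbPsi F r R (x + z) ≤ F (‖x‖ ^ 2 - r ^ 2)
          + Fp (‖x‖ ^ 2 - r ^ 2) * (2 * ⟪x, z⟫ + ‖z‖ ^ 2) := by
        unfold bbPsi
        rw [max_eq_left hy]
        have hm1 : r ≤ min ‖x + z‖ R := le_min hy hR1.le
        have hm2 : min ‖x + z‖ R ≤ ‖x + z‖ := min_le_left _ _
        set w := min ‖x + z‖ R
        have hc := bb_concave F Fp hF ha (‖x‖ ^ 2 - r ^ 2) (w ^ 2 - r ^ 2) hp0.le (by nlinarith)
        have hw : w ^ 2 ≤ ‖x + z‖ ^ 2 := by nlinarith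
        have := mul_le_mul_of_nonneg_left
          (show w ^ 2 - r ^ 2 - (‖x‖ ^ 2 - r ^ 2) ≤ 2 * ⟪x, z⟫ + ‖z‖ ^ 2 by linarith) hp.le
        linarith
      have h5 : Fp (‖x‖ ^ 2 - r ^ 2) * ‖z‖ ^ 2 ≤ ‖z‖ ^ 2 * 1 := by
        nlinarith [sq_nonneg ‖z‖]
      have h6 : ‖z‖ ^ 2 * 1 ≤ ‖z‖ ^ 2 * (1 + 16 * (‖z‖ / (‖x‖ ^ 2 - r ^ 2 + ‖z‖) ^ 2)) :=
        mul_le_mul_of_nonneg_left (by linarith) (by positivity)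
      linarith
  · rw [indicator_of_notMem (by simpa using hz)]
    push Not at hz
    rw [min_eq_right hz, min_eq_right (by nlinarith)]
    rw [min_eq_right hz] at hfrac
    have hle : bbPsi F r R (x + z) ≤ 3 / 4 := by
      unfold bbPsi
      have hm1 : r ≤ min (max ‖x + z‖ r) R := le_min (le_max_right _ _) hR1.le
      have hm2 : min (max ‖x + z‖ r) R ≤ R := min_le_right _ _
      set w := min (max ‖x + z‖ r) R
      have hc := bb_concave F Fp hF ha 0 (w ^ 2 - r ^ 2) le_rfl (by nlinarith)
      rw [hFz, hF0] at hc
      nlinarith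
    linarith

set_option maxHeartbeats 2000000 in
/-- the boundary barrier (Lemma 5.4). -/
theorem boundary_barrier {d : ℕ} (hd : 1 ≤ d) (lam Lam C0 : ℝ)
    (hlam : 0 < lam) (hLam : lam ≤ Lam) (hC0 : 0 ≤ C0)
    (K : Ed d → ℝ) (hK : KernCond K) :
    ∀ r : ℝ, 0 < r → r < 1 →
    ∃ ε₅ : ℝ, 0 < ε₅ ∧ ∃ δ₁ ∈ Ioo (0 : ℝ) 1, ∃ ψ : Ed d → ℝ,
      LipschitzWith (Real.toNNReal (1 / r)) ψ ∧
      (∀ x ∈ Metric.closedBall (0 : Ed d) r, ψ x = 0) ∧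
      (∀ x ∉ Metric.closedBall (0 : Ed d) r, 0 < ψ x) ∧
      (∀ x ∉ Metric.ball (0 : Ed d) ((1 + δ₁) * r), ε₅ ≤ ψ x) ∧
      ContDiffOn ℝ 2 ψ (Metric.ball (0 : Ed d) ((1 + δ₁) * r) \ Metric.closedBall (0 : Ed d) r) ∧
      ∀ x ∈ Metric.ball (0 : Ed d) ((1 + δ₁) * r) \ Metric.closedBall (0 : Ed d) r,
        pucciPlus lam Lam (hess ψ x) + nlPlus K 1 ψ x + C0 * ‖gradient ψ x‖ ≤ -1 := by
  intro r hr hr1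
  obtain ⟨hKm, hK0, hKi⟩ := hK
  set m : Ed d → ℝ := fun z => min (‖z‖ ^ 2) 1 * K z with hmdef
  have hmn : ∀ z, 0 ≤ m z := fun z =>
    mul_nonneg (le_min (by positivity) zero_le_one) (hK0 z)
  have hm0 : m 0 = 0 := by simp [hmdef]
  obtain ⟨I0, hI0⟩ : ∃ I0 : ℝ, I0 = ∫ z, m z := ⟨_, rfl⟩
  have hI0n : 0 ≤ I0 := by rw [hI0]; exact integral_nonneg hmn
  have hden : 0 < 4 * lam * r ^ 2 := by positivity
  have hLam0 : 0 < Lam := by linarith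
  have hLd : 0 ≤ Lam * (d : ℝ) := mul_nonneg hLam0.le (Nat.cast_nonneg d)
  have hMn : 0 ≤ (1 + I0 + Lam * d + C0) / (4 * lam * r ^ 2) :=
    div_nonneg (by linarith) hden.le
  have hCn : 0 ≤ 16 / (4 * lam * r ^ 2) := div_nonneg (by norm_num) hden.le
  obtain ⟨F, Fp, hFz, hF0, hFpc, hF, hFpp, ha, hFC⟩ :=
    bb_profile m hKi hm0 hmn _ _ hMn hCn
  -- choose the width
  obtain ⟨W, hW, hWpos⟩ : ∃ W > 0, ∀ p, 0 ≤ p → p ≤ W → 0 < Fp p := by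
    have hev : ∀ᶠ p in nhds (0:ℝ), 0 < Fp p :=
      hFpc.continuousAt.eventually_const_lt (by rw [hF0]; norm_num)
    obtain ⟨e, he, hb⟩ := Metric.eventually_nhds_iff.1 hev
    refine ⟨e / 2, by positivity, fun p hp hpe => hb ?_⟩
    rw [Real.dist_eq, sub_zero, abs_of_nonneg hp]
    linarith
  set δ : ℝ := min (1 / 2) (W / 3) with hδ
  have hδ0 : 0 < δ := lt_min (by norm_num) (by positivity)
  have hδ1 : δ ≤ 1 / 2 := min_le_left _ _
  have hδ2 : δ ≤ W / 3 := min_le_right _ _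
  set R : ℝ := (1 + δ) * r with hR
  have hR1 : r < R := by nlinarith
  have hR2 : R ≤ 2 * r := by nlinarith
  have hRW : R ^ 2 - r ^ 2 ≤ W := by
    have e : R ^ 2 - r ^ 2 = δ * (2 + δ) * r ^ 2 := by rw [hR]; ring
    have h1 : δ * (2 + δ) * r ^ 2 ≤ δ * (2 + δ) * 1 :=
      mul_le_mul_of_nonneg_left (by nlinarith) (by positivity)
    nlinarith
  have hpos : ∀ p, 0 ≤ p → p ≤ R ^ 2 - r ^ 2 → 0 < Fp p := fun p h1 h2 =>
    hWpos p h1 (h2.trans hRW)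
  have hFpos : ∀ p, 0 < p → p ≤ R ^ 2 - r ^ 2 → 0 < F p := by
    intro p h1 h2
    have := bb_concave F Fp hF ha p 0 h1.le le_rfl
    rw [hFz] at this
    have := mul_pos (hpos p h1.le h2) h1
    nlinarith
  have hann : ∀ x ∈ Metric.ball (0 : Ed d) R \ Metric.closedBall (0 : Ed d) r,
      r < ‖x‖ ∧ ‖x‖ < R := by
    rintro x ⟨h1, h2⟩
    rw [mem_ball_zero_iff] at h1
    rw [mem_closedBall_zero_iff, not_le] at h2
    exact ⟨h2, h1⟩
  refine ⟨F (R ^ 2 - r ^ 2), hFpos _ (by nlinarith) le_rfl, δ, ⟨hδ0, by linarith⟩, bbPsi F r R,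
    bb_lip F Fp hF ha hF0 r R hr hr1 hR1 hR2 hpos, ?_, ?_, ?_, ?_, ?_⟩
  · intro x hx
    exact bb_psi_in F r R hR1.le hFz x (by simpa using hx)
  · intro x hx
    rw [mem_closedBall_zero_iff, not_le] at hx
    rw [bbPsi, max_eq_left hx.le]
    have h1 : r < min ‖x‖ R := lt_min hx hR1
    have h2 : min ‖x‖ R ≤ R := min_le_right _ _
    exact hFpos _ (by nlinarith) (by nlinarith)
  · intro x hx
    rw [mem_ball_zero_iff, not_lt] at hx
    rw [bbPsi, max_eq_left (hR1.le.trans hx), min_eq_right hx]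
  · have : ContDiffOn ℝ 2 (fun y : Ed d => F (‖y‖ ^ 2 - r ^ 2))
        (Metric.ball (0 : Ed d) R \ Metric.closedBall (0 : Ed d) r) := by
      refine hFC.comp (t := Ioi 0) (f := fun y : Ed d => ‖y‖ ^ 2 - r ^ 2) ?_ ?_
      · exact ((contDiff_norm_sq ℝ).sub contDiff_const).contDiffOn
      · intro x hx
        have := hann x hx
        show 0 < ‖x‖ ^ 2 - r ^ 2
        nlinarith
    refine this.congr fun x hx => ?_
    exact bb_psi_eq F r R x (hann x hx).1.le (hann x hx).2.le
  · intro x hx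
    obtain ⟨h1, h2⟩ := hann x hx
    have hp0 : 0 < ‖x‖ ^ 2 - r ^ 2 := by nlinarith
    have hpR : ‖x‖ ^ 2 - r ^ 2 ≤ R ^ 2 - r ^ 2 := by nlinarith
    have hp : 0 < Fp (‖x‖ ^ 2 - r ^ 2) := hpos _ hp0.le hpR
    have hq : Fp (‖x‖ ^ 2 - r ^ 2) ≤ 1 / 4 := by
      rw [← hF0]; exact ha (self_mem_Ici) hp0.le hp0.le
    set J : ℝ := ∫ z, m z * (min ‖z‖ 1 / (‖x‖ ^ 2 - r ^ 2 + min ‖z‖ 1) ^ 2) with hJ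
    have hJi := (bb_Hder m hKi _ hp0).1
    have hJn : 0 ≤ J := by
      apply integral_nonneg
      intro z
      have hτ : 0 ≤ min ‖z‖ 1 := le_min (norm_nonneg z) zero_le_one
      have := hmn z
      show 0 ≤ m z * (min ‖z‖ 1 / (‖x‖ ^ 2 - r ^ 2 + min ‖z‖ 1) ^ 2)
      positivity
    -- gradient term
    have hg : ‖gradient (bbPsi F r R) x‖ ≤ 1 := by
      rw [bb_gradient F Fp hF r R x h1 h2, norm_smul, Real.norm_eq_abs,
        abs_of_pos (by linarith)]
      nlinarith [norm_nonneg x]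
    have hg' : C0 * ‖gradient (bbPsi F r R) x‖ ≤ C0 := mul_le_of_le_one_right hC0 hg
    -- nonlocal term
    have hnl : nlPlus K 1 (bbPsi F r R) x ≤ I0 + 16 * J := by
      have e : I0 + 16 * J = ∫ z, (m z +
          16 * (m z * (min ‖z‖ 1 / (‖x‖ ^ 2 - r ^ 2 + min ‖z‖ 1) ^ 2))) := by
        rw [integral_add hKi (hJi.const_mul 16), integral_const_mul, hI0]
      rw [e]
      unfold nlPlus
      have hKr : ∀ z, Kresc K 1 z = K z := fun z => by simp [Kresc]
      apply integral_mono_of_nonneg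
      · refine Filter.Eventually.of_forall fun z => ?_
        show 0 ≤ max (deltaOp (bbPsi F r R) 1 x z) 0 * Kresc K 1 z
        rw [hKr]
        exact mul_nonneg (le_max_right _ _) (hK0 z)
      · exact hKi.add (hJi.const_mul 16)
      · refine Filter.Eventually.of_forall fun z => ?_
        show max (deltaOp (bbPsi F r R) 1 x z) 0 * Kresc K 1 z ≤ _
        rw [hKr]
        have := mul_le_mul_of_nonneg_right
          (bb_delta F Fp hF ha hFz hF0 r R hr hr1 hR1 hR2 hpos x z h1 h2) (hK0 z)
        refine this.trans (le_of_eq ?_)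
        simp only [hmdef]
        ring
    -- local term
    set D : ℝ := -((1 + I0 + Lam * d + C0) / (4 * lam * r ^ 2)) - 16 / (4 * lam * r ^ 2) * J
      with hD
    have hDn : D ≤ 0 := by
      have := mul_nonneg hCn hJn
      linarith
    have hloc : pucciPlus lam Lam (hess (bbPsi F r R) x)
        ≤ -(1 + I0 + Lam * d + C0) - 16 * J + Lam * d := by
      rw [bb_hess F Fp hF r (bbPsi F r R) x (bb_psi_ev F r R x h1 h2) D (hFpp _ hp0)]
      refine (bb_pucci lam Lam hLam x _ _ (by linarith) (by linarith)).trans ?_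
      have e : 4 * D * (lam * r ^ 2) = -(1 + I0 + Lam * d + C0) - 16 * J := by
        rw [hD]; field_simp
      have h3 : 4 * D * (lam * ‖x‖ ^ 2) ≤ 4 * D * (lam * r ^ 2) := by
        apply mul_le_mul_of_nonpos_left _ (by linarith)
        exact mul_le_mul_of_nonneg_left (by linarith) hlam.le
      have h4 : 2 * Fp (‖x‖ ^ 2 - r ^ 2) * (Lam * d) ≤ Lam * d :=
        mul_le_of_le_one_left (by positivity) (by linarith)
      linarith
    linarith
end
end
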